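/- Let τ > 1 and let ω ∈ ℝ satisfy inf_{q ≥ 1, q ∈ ℤ} q^τ·‖qω‖ > 0, and let λ ∈ ℂ with 0 < |λ| < 1. Then there exists σ ∈ (0,1) such that for every η ≥ 1 there is N₀ with the following property: for all N ≥ N₀, all β, γ ∈ ∂𝔻, and all x, y ∈ 𝕋, setting α_n = λ·e(y + n·x + n(n−1)·ω), there exist ψ ∈ ℂ^N with ‖ψ‖₂ = 1, ψ(0) = ψ(1) = 0 and ψ(n) = 0 for all n ≥ N^σ, and ϑ ∈ ℝ, such that ‖(ℰ^{[0,N−1]}_{β,γ} − e(ϑ)·I)·ψ‖₂ ≤ N^{−η}. -/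

import Mathlib

open scoped ComplexConjugate Matrix

noncomputable section

namespace CMV

/-- `e t = exp(2πi t)`. -/
def e (t : ℝ) : ℂ := Complex.exp (2 * Real.pi * Complex.I * t)

/-- `ρ n = (1 - |α n|^2)^{1/2}`, as a complex number. -/
def rho (α : ℤ → ℂ) (n : ℤ) : ℂ := ((1 - ‖α n‖ ^ 2).sqrt : ℝ)

/-- Entries of the doubly infinite matrix `𝓛 = ⊕_{n even} Θ n`. -/
def cmvL (α : ℤ → ℂ) (i j : ℤ) : ℂ :=
  if Even i ∧ j = i then conj (α i)
  else if Even i ∧ j = i + 1 then rho α i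
  else if Even j ∧ i = j + 1 then rho α j
  else if Odd i ∧ j = i then -α (i - 1)
  else 0

/-- Entries of the doubly infinite matrix `𝓜 = ⊕_{n odd} Θ n`. -/
def cmvM (α : ℤ → ℂ) (i j : ℤ) : ℂ :=
  if Odd i ∧ j = i then conj (α i)
  else if Odd i ∧ j = i + 1 then rho α i
  else if Odd j ∧ i = j + 1 then rho α j
  else if Even i ∧ j = i then -α (i - 1)
  else 0

/-- Coefficients modified at both boundaries: `α̃ (a-1) = β`, `α̃ b = γ`. -/
def modA (α : ℤ → ℂ) (a b : ℤ) (β γ : ℂ) (n : ℤ) : ℂ :=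
  if n = a - 1 then β else if n = b then γ else α n

/-- Coefficients modified only at the left boundary (`•` on the right). -/
def modL (α : ℤ → ℂ) (a : ℤ) (β : ℂ) (n : ℤ) : ℂ :=
  if n = a - 1 then β else α n

/-- Coefficients modified only at the right boundary (`•` on the left). -/
def modR (α : ℤ → ℂ) (b : ℤ) (γ : ℂ) (n : ℤ) : ℂ :=
  if n = b then γ else α n

/-- Principal submatrix of `𝓛` on rows and columns `{a, …, b}`. -/
def subL (αm : ℤ → ℂ) (a b : ℤ) : Matrix (Set.Icc a b) (Set.Icc a b) ℂ :=
  fun i j => cmvL αm i j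

/-- Principal submatrix of `𝓜` on rows and columns `{a, …, b}`. -/
def subM (αm : ℤ → ℂ) (a b : ℤ) : Matrix (Set.Icc a b) (Set.Icc a b) ℂ :=
  fun i j => cmvM αm i j

/-- The finite CMV matrix `ℰ^{[a,b]}`. -/
def cmvE (αm : ℤ → ℂ) (a b : ℤ) : Matrix (Set.Icc a b) (Set.Icc a b) ℂ :=
  subL αm a b * subM αm a b

/-- `φ^{[a,b]}` as a polynomial: the characteristic polynomial of the finite CMV
matrix built from the (modified) coefficients `αm`, normalized by the unmodified
`ρ`'s of `α`. -/
def phiP (α αm : ℤ → ℂ) (a b : ℤ) : Polynomial ℂ :=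
  Polynomial.C (∏ n ∈ Finset.Icc a b, rho α n)⁻¹ * (cmvE αm a b).charpoly

end CMV

open CMV


theorem pow_mul_geometric_le (κ : ℕ) {C r : ℝ} (hC : 0 ≤ C) (hr : 0 ≤ r) (m : ℕ) :
    r ^ m * (C * (m : ℝ) ^ κ) ≤ C * κ.factorial * (((m + κ).choose κ : ℝ) * r ^ m) := by
  have h1 : m ^ κ ≤ κ.factorial * (m + κ).choose κ := by
    rw [← Nat.ascFactorial_eq_factorial_mul_choose]
    exact (Nat.pow_le_pow_left (Nat.le_succ m) κ).trans (Nat.pow_succ_le_ascFactorial _ _)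
  have h2 : (m : ℝ) ^ κ ≤ κ.factorial * (m + κ).choose κ := by exact_mod_cast h1
  calc r ^ m * (C * (m : ℝ) ^ κ) = (C * r ^ m) * (m : ℝ) ^ κ := by ring
    _ ≤ (C * r ^ m) * (κ.factorial * (m + κ).choose κ) := by gcongr
    _ = _ := by ring

theorem hasSum_pow_mul_geometric_bound (κ : ℕ) (C : ℝ) {r : ℝ} (hr : 0 ≤ r) (hr1 : r < 1) :
    HasSum (fun m : ℕ => C * κ.factorial * (((m + κ).choose κ : ℝ) * r ^ m))
      (C * κ.factorial * (1 / (1 - r) ^ (κ + 1))) := by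
  have h := hasSum_choose_mul_geometric_of_norm_lt_one (𝕜 := ℝ) κ (r := r)
    (by rwa [Real.norm_of_nonneg hr])
  exact h.mul_left (C * (κ.factorial : ℝ))

/-- If the power sums of points in the closed unit disc grow polynomially, then
the logarithmic potential of the points is bounded below inside the disc. -/
theorem sum_log_norm_ge {d κ : ℕ} {C r : ℝ} (hC : 0 ≤ C) (hr : 0 ≤ r) (hr1 : r < 1)
    (w : Fin d → ℂ) (hw : ∀ i, ‖w i‖ ≤ 1)
    (hp : ∀ m : ℕ, 1 ≤ m → ‖∑ i, w i ^ m‖ ≤ C * (m : ℝ) ^ κ) (z : ℂ) (hz : ‖z‖ ≤ 1) :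
    -(C * κ.factorial * (1 / (1 - r) ^ (κ + 1))) ≤ ∑ i, Real.log ‖1 - r * z * w i‖ := by
  have hs : ∀ i, ‖(r : ℂ) * z * w i‖ < 1 := fun i => by
    rw [norm_mul, norm_mul, Complex.norm_real, Real.norm_of_nonneg hr]
    calc r * ‖z‖ * ‖w i‖ ≤ r * 1 * 1 := by
          gcongr
          exact hw i
      _ < 1 := by simpa using hr1
  have h1 : HasSum (fun m : ℕ => ∑ i, ((r : ℂ) * z * w i) ^ m / m)
      (∑ i, -Complex.log (1 - r * z * w i)) :=
    hasSum_sum fun i _ => Complex.hasSum_taylorSeries_neg_log (hs i)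
  have h2 := h1.norm_le_of_bounded (hasSum_pow_mul_geometric_bound κ C hr hr1) (fun m => by
    refine le_trans ?_ (pow_mul_geometric_le κ hC hr m)
    rcases Nat.eq_zero_or_pos m with rfl | hm
    · simp only [CharP.cast_eq_zero, div_zero, Finset.sum_const_zero, norm_zero]; positivity
    have : ∑ i, ((r : ℂ) * z * w i) ^ m / m = (r * z) ^ m / m * ∑ i, w i ^ m := by
      rw [Finset.mul_sum]; exact Finset.sum_congr rfl fun i _ => by rw [mul_pow]; ring
    rw [this, norm_mul, norm_div, norm_pow, norm_mul, Complex.norm_real, Real.norm_of_nonneg hr,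
      Complex.norm_natCast]
    have hm1 : (1 : ℝ) ≤ m := by exact_mod_cast hm
    have : (r * ‖z‖) ^ m / m ≤ r ^ m := by
      refine (div_le_self (by positivity) hm1).trans ?_
      exact pow_le_pow_left₀ (by positivity) (mul_le_of_le_one_right hr hz) m
    exact mul_le_mul this (hp m hm) (norm_nonneg _) (by positivity))
  have h3 : (∑ i, Real.log ‖1 - r * z * w i‖) = -(∑ i, -Complex.log (1 - r * z * w i)).re := by
    rw [Finset.sum_neg_distrib, Complex.neg_re, neg_neg, Complex.re_sum]
    exact Finset.sum_congr rfl fun i _ => (Complex.log_re _).symm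
  rw [h3]
  exact neg_le_neg ((Complex.re_le_norm _).trans h2)

/-- If the power sums of points in the closed unit disc grow polynomially, then
the points do not cluster. -/
theorem card_norm_le_le {d κ : ℕ} {C t : ℝ} (hC : 0 ≤ C) (ht : 0 < t) (ht1 : t ≤ 1)
    (w : Fin d → ℂ) (hw : ∀ i, ‖w i‖ ≤ 1)
    (hp : ∀ m : ℕ, 1 ≤ m → ‖∑ i, w i ^ m‖ ≤ C * (m : ℝ) ^ κ) (z : ℂ) (hz : ‖z‖ ≤ 1) :
    ((Finset.univ.filter fun i => ‖1 - z * w i‖ ≤ t).card : ℝ) ≤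
      4 * t * d + 8 * C * κ.factorial * (t⁻¹) ^ κ := by
  set r : ℝ := 1 - t with hrdef
  have hr : 0 ≤ r := by linarith
  have hr1 : r < 1 := by linarith
  have hzw : ∀ i, ‖z * w i‖ ≤ 1 := fun i => by
    rw [norm_mul]; exact mul_le_one₀ hz (norm_nonneg _) (hw i)
  have hsr : ∀ i, ‖(r : ℂ) * z * w i‖ ≤ r := fun i => by
    rw [mul_assoc, norm_mul, Complex.norm_real, Real.norm_of_nonneg hr]
    exact mul_le_of_le_one_right hr (hzw i)
  have hs : ∀ i, ‖(r : ℂ) * z * w i‖ < 1 := fun i => (hsr i).trans_lt hr1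
  have h1 : HasSum (fun m : ℕ => ∑ i, ((r : ℂ) * z * w i) ^ m * ((r : ℂ) * z * w i))
      (∑ i, (1 - (r : ℂ) * z * w i)⁻¹ * ((r : ℂ) * z * w i)) :=
    hasSum_sum fun i _ => (hasSum_geometric_of_norm_lt_one (hs i)).mul_right _
  have hg := (hasSum_nat_add_iff' 1).2 (hasSum_pow_mul_geometric_bound κ C hr hr1)
  have h2 := h1.norm_le_of_bounded hg (fun m => by
    refine le_trans ?_ (pow_mul_geometric_le κ hC hr (m + 1))
    have : ∑ i, ((r : ℂ) * z * w i) ^ m * ((r : ℂ) * z * w i)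
        = (r * z) ^ (m + 1) * ∑ i, w i ^ (m + 1) := by
      rw [Finset.mul_sum]; exact Finset.sum_congr rfl fun i _ => by ring
    rw [this, norm_mul, norm_pow, norm_mul, Complex.norm_real, Real.norm_of_nonneg hr]
    refine mul_le_mul ?_ (hp (m + 1) (by omega)) (norm_nonneg _) (by positivity)
    exact pow_le_pow_left₀ (by positivity) (mul_le_of_le_one_right hr hz) _)
  have h3 : ‖∑ i, (1 - (r : ℂ) * z * w i)⁻¹ * ((r : ℂ) * z * w i)‖ ≤
      C * κ.factorial * (1 / t ^ (κ + 1)) := by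
    refine h2.trans ?_
    have : (1 : ℝ) - r = t := by rw [hrdef]; ring
    rw [this, sub_le_self_iff]
    exact Finset.sum_nonneg fun _ _ => by positivity
  have hpos : ∀ i, 0 < ‖1 - (r : ℂ) * z * w i‖ := fun i => by
    rw [norm_pos_iff, sub_ne_zero]
    rintro h; have := hs i; rw [← h] at this; simp at this
  have key : ∀ s : ℂ, 1 - s ≠ 0 → 1 + 2 * ((1 - s)⁻¹ * s).re = (1 - ‖s‖ ^ 2) / ‖1 - s‖ ^ 2 := by
    intro s hs0
    have hn : Complex.normSq (1 - s) ≠ 0 := by simpa using hs0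
    have e1 : ‖s‖ ^ 2 = s.re * s.re + s.im * s.im := by
      rw [← Complex.normSq_eq_norm_sq, Complex.normSq_apply]
    have e2 : Complex.normSq (1 - s) = (1 - s.re) * (1 - s.re) + s.im * s.im := by
      rw [Complex.normSq_apply]; simp
    rw [e1, ← Complex.normSq_eq_norm_sq, Complex.mul_re, Complex.inv_re, Complex.inv_im]
    field_simp
    rw [e2]; simp; ring
  have h4 : ∀ i, (if ‖1 - z * w i‖ ≤ t then 1 / (4 * t) else 0) ≤
      1 + 2 * ((1 - (r : ℂ) * z * w i)⁻¹ * ((r : ℂ) * z * w i)).re := by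
    intro i
    rw [key _ (norm_pos_iff.1 (hpos i))]
    have hsq : ‖(r : ℂ) * z * w i‖ ^ 2 ≤ r := by
      have := hsr i
      nlinarith [norm_nonneg ((r : ℂ) * z * w i)]
    split_ifs with hi
    · have h5 : ‖1 - (r : ℂ) * z * w i‖ ≤ 2 * t := by
        have : 1 - (r : ℂ) * z * w i = (1 - z * w i) + (t : ℂ) * (z * w i) := by
          rw [hrdef]; push_cast; ring
        rw [this]
        refine (norm_add_le _ _).trans ?_
        rw [norm_mul, Complex.norm_real, Real.norm_of_nonneg ht.le]
        nlinarith [hzw i, norm_nonneg (z * w i)]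
      rw [div_le_div_iff₀ (by positivity) (pow_pos (hpos i) 2)]
      have : ‖1 - (r : ℂ) * z * w i‖ ^ 2 ≤ (2 * t) ^ 2 := pow_le_pow_left₀ (norm_nonneg _) h5 2
      have h6 : t ≤ 1 - ‖(r : ℂ) * z * w i‖ ^ 2 := by linarith
      nlinarith
    · exact div_nonneg (by linarith) (by positivity)
  have h5 := Finset.sum_le_sum fun i (_ : i ∈ Finset.univ) => h4 i
  rw [← Finset.sum_filter, Finset.sum_const, Finset.sum_add_distrib, ← Finset.mul_sum,
    ← Complex.re_sum] at h5
  have h6 := (Complex.re_le_norm _).trans h3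
  simp only [nsmul_eq_mul, Finset.sum_const, Finset.card_univ, Fintype.card_fin, mul_one] at h5
  have h7 : ((Finset.univ.filter fun i => ‖1 - z * w i‖ ≤ t).card : ℝ) ≤
      4 * t * (d + 2 * (C * κ.factorial * (1 / t ^ (κ + 1)))) := by
    rw [mul_one_div, div_le_iff₀ (by positivity)] at h5
    nlinarith
  refine h7.trans (le_of_eq ?_)
  rw [inv_pow]
  field_simp
  ring


/-- Points in the closed unit disc whose power sums grow polynomially. -/
def PowerSumsLE (C : ℝ) (κ : ℕ) {d : ℕ} (w : Fin d → ℂ) : Prop :=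
  (∀ i, ‖w i‖ ≤ 1) ∧ ∀ m : ℕ, 1 ≤ m → ‖∑ i, w i ^ m‖ ≤ C * (m : ℝ) ^ κ

theorem sum_log_norm_one_sub_ge {d : ℕ} {r t δ : ℝ} (hr : 0 ≤ r) (hr1 : r < 1) (ht : 0 < t)
    (hδ : 0 < δ) (w : Fin d → ℂ) (hw : ∀ i, ‖w i‖ ≤ 1) {z : ℂ} (hz : ‖z‖ ≤ 1)
    (hzw : ∀ i, δ ≤ ‖1 - z * w i‖) :
    (∑ i, Real.log ‖1 - r * z * w i‖) - (d * ((1 - r) / t) +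
        Real.log (1 + δ⁻¹) * (Finset.univ.filter fun i => ‖1 - z * w i‖ ≤ t).card) ≤
      ∑ i, Real.log ‖1 - z * w i‖ := by
  have hlog : 0 ≤ Real.log (1 + δ⁻¹) := Real.log_nonneg (by
    have := inv_pos.2 hδ
    linarith)
  have h1 : ∀ i, Real.log ‖1 - r * z * w i‖ - (((1 - r) / t) +
      if ‖1 - z * w i‖ ≤ t then Real.log (1 + δ⁻¹) else 0) ≤ Real.log ‖1 - z * w i‖ := by
    intro i
    have hp : 0 < ‖1 - z * w i‖ := hδ.trans_le (hzw i)
    have hzw1 : ‖z * w i‖ ≤ 1 := by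
      rw [norm_mul]; exact mul_le_one₀ hz (norm_nonneg _) (hw i)
    have hp' : 0 < ‖1 - r * z * w i‖ := by
      rw [norm_pos_iff, sub_ne_zero]
      intro h
      have h2 : ‖(r : ℂ) * z * w i‖ < 1 := by
        rw [mul_assoc, norm_mul, Complex.norm_real, Real.norm_of_nonneg hr]
        exact (mul_le_of_le_one_right hr hzw1).trans_lt hr1
      rw [← h] at h2; simp at h2
    set x := (1 - r) / ‖1 - z * w i‖ with hx
    have hx0 : 0 ≤ x := div_nonneg (by linarith) hp.le
    have h2 : ‖1 - r * z * w i‖ ≤ ‖1 - z * w i‖ * (1 + x) := by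
      have : 1 - (r : ℂ) * z * w i = (1 - z * w i) + ((1 - r : ℝ) : ℂ) * (z * w i) := by
        push_cast; ring
      rw [this, hx, mul_add, mul_div_cancel₀ _ hp.ne', mul_one]
      refine (norm_add_le _ _).trans ?_
      rw [norm_mul, Complex.norm_real, Real.norm_of_nonneg (by linarith : (0 : ℝ) ≤ 1 - r)]
      nlinarith
    have h3 := Real.log_le_log hp' h2
    rw [Real.log_mul hp.ne' (by positivity)] at h3
    have h4 : Real.log (1 + x) ≤
        ((1 - r) / t) + if ‖1 - z * w i‖ ≤ t then Real.log (1 + δ⁻¹) else 0 := by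
      have hrt : 0 ≤ (1 - r) / t := div_nonneg (by linarith) ht.le
      split_ifs with hi
      · have : Real.log (1 + x) ≤ Real.log (1 + δ⁻¹) := by
          refine Real.log_le_log (by positivity) ?_
          have : x ≤ 1 / δ := by
            rw [hx]; exact div_le_div₀ zero_le_one (by linarith) hδ (hzw i)
          rw [one_div] at this
          linarith
        linarith
      · have : x ≤ (1 - r) / t :=
          div_le_div_of_nonneg_left (by linarith) ht (not_le.1 hi).le
        have := Real.log_le_sub_one_of_pos (by positivity : (0 : ℝ) < 1 + x)
        linarith
    linarith
  have h2 := Finset.sum_le_sum fun i (_ : i ∈ Finset.univ) => h1 i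
  rw [Finset.sum_sub_distrib, Finset.sum_add_distrib, ← Finset.sum_filter] at h2
  simp only [Finset.sum_const, Finset.card_univ, Fintype.card_fin, nsmul_eq_mul] at h2
  rwa [mul_comm (Real.log (1 + δ⁻¹))]

/-- The constant in `PowerSumsLE.sum_log_ge`. -/
def potentialConst (C : ℝ) (κ : ℕ) : ℝ :=
  C * κ.factorial + 1 + (2 * (4 * κ + 5) + 1) * (4 + 8 * C * κ.factorial)

theorem PowerSumsLE.sum_log_ge {d κ : ℕ} {C : ℝ} {w : Fin d → ℂ} (h : PowerSumsLE C κ w)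
    (hC : 0 ≤ C) {s : ℕ} (hs : 2 ≤ s) (hd : d ≤ s ^ (4 * κ + 5)) {z : ℂ} (hz : ‖z‖ ≤ 1)
    (hzw : ∀ i, ((s : ℝ) ^ (2 * (4 * κ + 5)))⁻¹ ≤ ‖1 - z * w i‖) :
    -(potentialConst C κ * (s : ℝ) ^ (4 * κ + 4)) ≤ ∑ i, Real.log ‖1 - z * w i‖ := by
  have hs2 : (2 : ℝ) ≤ s := by exact_mod_cast hs
  have hs0 : (0 : ℝ) < s := by linarith
  have hs1 : (1 : ℝ) ≤ s := by linarith
  have hd' : (d : ℝ) ≤ (s : ℝ) ^ (4 * κ + 5) := by exact_mod_cast hd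
  have hi4 : ((s : ℝ) ^ 4)⁻¹ ≤ 1 := inv_le_one_of_one_le₀ (one_le_pow₀ hs1)
  have hi2 : ((s : ℝ) ^ 2)⁻¹ ≤ 1 := inv_le_one_of_one_le₀ (one_le_pow₀ hs1)
  have hr : (0 : ℝ) ≤ 1 - ((s : ℝ) ^ 4)⁻¹ := by linarith
  have hr1 : 1 - ((s : ℝ) ^ 4)⁻¹ < 1 := by
    have : (0 : ℝ) < ((s : ℝ) ^ 4)⁻¹ := by positivity
    linarith
  have h1 := sum_log_norm_one_sub_ge hr hr1 (t := ((s : ℝ) ^ 2)⁻¹) (by positivity)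
    (by positivity) w h.1 hz hzw
  have h2 := sum_log_norm_ge hC hr hr1 w h.1 h.2 z hz
  have h3 := card_norm_le_le hC (t := ((s : ℝ) ^ 2)⁻¹) (by positivity) hi2 w h.1 h.2 z hz
  have e1 : C * κ.factorial * (1 / (1 - (1 - ((s : ℝ) ^ 4)⁻¹)) ^ (κ + 1)) =
      C * κ.factorial * (s : ℝ) ^ (4 * κ + 4) := by
    rw [sub_sub_cancel, inv_pow, one_div, inv_inv, ← pow_mul]; ring_nf
  have e2 : (1 - (1 - ((s : ℝ) ^ 4)⁻¹)) / ((s : ℝ) ^ 2)⁻¹ = ((s : ℝ) ^ 2)⁻¹ := by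
    field_simp; ring
  rw [e1] at h2
  rw [e2, inv_inv] at h1
  rw [inv_inv, ← pow_mul] at h3
  set q := (s : ℝ) ^ (4 * κ + 4) with hq
  have hq0 : 0 ≤ q := by positivity
  have hd2 : (d : ℝ) * ((s : ℝ) ^ 2)⁻¹ * s ≤ q := by
    have : (d : ℝ) * ((s : ℝ) ^ 2)⁻¹ * s = d / s := by field_simp
    rw [this, div_le_iff₀ hs0, hq, ← pow_succ]
    exact hd'
  have hd0 : 0 ≤ (d : ℝ) * ((s : ℝ) ^ 2)⁻¹ := by positivity
  have hlog : Real.log (1 + (s : ℝ) ^ (2 * (4 * κ + 5))) ≤ (2 * (4 * κ + 5) + 1) * s := by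
    have : 1 + (s : ℝ) ^ (2 * (4 * κ + 5)) ≤ (s : ℝ) ^ (2 * (4 * κ + 5) + 1) := by
      rw [pow_succ]
      have : (1 : ℝ) ≤ (s : ℝ) ^ (2 * (4 * κ + 5)) := one_le_pow₀ hs1
      nlinarith
    refine (Real.log_le_log (by positivity) this).trans ?_
    rw [Real.log_pow]
    push_cast
    gcongr
    exact Real.log_le_self hs0.le
  have hlog0 : 0 ≤ Real.log (1 + (s : ℝ) ^ (2 * (4 * κ + 5))) :=
    Real.log_nonneg (by linarith [pow_pos hs0 (2 * (4 * κ + 5))])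
  have hqs : (s : ℝ) ^ (2 * κ) * s ≤ q := by
    rw [hq, ← pow_succ]
    exact pow_le_pow_right₀ hs1 (by omega)
  have h4 : Real.log (1 + (s : ℝ) ^ (2 * (4 * κ + 5))) *
      (Finset.univ.filter fun i => ‖1 - z * w i‖ ≤ ((s : ℝ) ^ 2)⁻¹).card ≤
      (2 * (4 * κ + 5) + 1) * (4 + 8 * C * κ.factorial) * q := by
    calc _ ≤ ((2 * (4 * κ + 5) + 1) * s) *
          (4 * ((s : ℝ) ^ 2)⁻¹ * d + 8 * C * κ.factorial * (s : ℝ) ^ (2 * κ)) := by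
          gcongr
      _ = (2 * (4 * κ + 5) + 1) * (4 * (d * ((s : ℝ) ^ 2)⁻¹ * s) +
          8 * C * κ.factorial * ((s : ℝ) ^ (2 * κ) * s)) := by ring
      _ ≤ (2 * (4 * κ + 5) + 1) * (4 * q + 8 * C * κ.factorial * q) := by gcongr
      _ = _ := by ring
  have h5 : (d : ℝ) * ((s : ℝ) ^ 2)⁻¹ ≤ q := by nlinarith
  rw [potentialConst]
  linarith

/-- Two families of polynomially bounded power sums: most of the points of the larger family are
far from all reflected points of the smaller one. -/
theorem PowerSumsLE.card_exists_norm_lt {d κ M : ℕ} {C δ : ℝ} {w : Fin d → ℂ} {z : Fin M → ℂ}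
    (hw : ∀ i, ‖w i‖ ≤ 1) (hz : PowerSumsLE C κ z) (hC : 0 ≤ C) (hδ : 0 < δ) (hδ1 : δ ≤ 1) :
    ((Finset.univ.filter fun j => ∃ i, ‖1 - z j * w i‖ < δ).card : ℝ) ≤
      d * (4 * δ * M + 8 * C * κ.factorial * (δ⁻¹) ^ κ) := by
  classical
  have h1 : (Finset.univ.filter fun j => ∃ i, ‖1 - z j * w i‖ < δ) ⊆
      Finset.univ.biUnion fun i => Finset.univ.filter fun j => ‖1 - w i * z j‖ ≤ δ := by
    intro j hj
    obtain ⟨i, hi⟩ := (Finset.mem_filter.1 hj).2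
    refine Finset.mem_biUnion.2 ⟨i, Finset.mem_univ _, Finset.mem_filter.2 ⟨Finset.mem_univ _, ?_⟩⟩
    rw [mul_comm]; exact hi.le
  calc ((Finset.univ.filter fun j => ∃ i, ‖1 - z j * w i‖ < δ).card : ℝ)
      ≤ ((∑ i, (Finset.univ.filter fun j => ‖1 - w i * z j‖ ≤ δ).card : ℕ) : ℝ) := by
        exact_mod_cast (Finset.card_le_card h1).trans Finset.card_biUnion_le
    _ ≤ ∑ _i : Fin d, (4 * δ * M + 8 * C * κ.factorial * (δ⁻¹) ^ κ) := by
        push_cast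
        exact Finset.sum_le_sum fun i _ => card_norm_le_le hC hδ hδ1 z hz.1 hz.2 _ (hw i)
    _ = _ := by simp; ring

/-- If `M` is a large power of `n`, two families of at most `n` points leave one of the `M` points
of a family with polynomially bounded power sums that is far from all their reflections. -/
theorem PowerSumsLE.exists_far {d d' κ n : ℕ} {C : ℝ} {w : Fin d → ℂ} {w' : Fin d' → ℂ}
    {z : Fin (2 * n ^ (2 * κ + 2)) → ℂ}
    (hw : ∀ i, ‖w i‖ ≤ 1) (hw' : ∀ i, ‖w' i‖ ≤ 1) (hd : d ≤ n) (hd' : d' ≤ n)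
    (hz : PowerSumsLE C κ z) (hC : 0 ≤ C) (hn : 2 * (4 + 8 * C * κ.factorial) < n) :
    ∃ j, (∀ i, ((n : ℝ) ^ 2)⁻¹ ≤ ‖1 - z j * w i‖) ∧ (∀ i, ((n : ℝ) ^ 2)⁻¹ ≤ ‖1 - z j * w' i‖) := by
  classical
  by_contra! hcon
  have hK : 0 ≤ 8 * C * (κ.factorial : ℝ) := by positivity
  have hn1 : (1 : ℝ) ≤ n := by linarith
  have hn0 : (0 : ℝ) < n := by linarith
  set δ : ℝ := ((n : ℝ) ^ 2)⁻¹ with hδd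
  have hδ : 0 < δ := by positivity
  have hδ1 : δ ≤ 1 := inv_le_one_of_one_le₀ (one_le_pow₀ hn1)
  have hcover : (Finset.univ : Finset (Fin (2 * n ^ (2 * κ + 2)))) ⊆
      (Finset.univ.filter fun j => ∃ i, ‖1 - z j * w i‖ < δ) ∪
      (Finset.univ.filter fun j => ∃ i, ‖1 - z j * w' i‖ < δ) := by
    intro j _
    rw [Finset.mem_union, Finset.mem_filter, Finset.mem_filter]
    by_cases h : ∀ i, δ ≤ ‖1 - z j * w i‖
    · exact Or.inr ⟨Finset.mem_univ _, hcon j h⟩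
    · push Not at h
      exact Or.inl ⟨Finset.mem_univ _, h⟩
  have hcard := (Finset.card_le_card hcover).trans (Finset.card_union_le _ _)
  rw [Finset.card_univ, Fintype.card_fin] at hcard
  have hcard' : (2 * (n : ℝ) ^ (2 * κ + 2)) ≤
      ((Finset.univ.filter fun j => ∃ i, ‖1 - z j * w i‖ < δ).card : ℝ) +
      ((Finset.univ.filter fun j => ∃ i, ‖1 - z j * w' i‖ < δ).card : ℝ) := by
    exact_mod_cast hcard
  have hb : ∀ {d : ℕ} {w : Fin d → ℂ}, (∀ i, ‖w i‖ ≤ 1) → d ≤ n →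
      ((Finset.univ.filter fun j => ∃ i, ‖1 - z j * w i‖ < δ).card : ℝ) ≤
        2 * (4 + 8 * C * κ.factorial) * (n : ℝ) ^ (2 * κ + 1) := by
    intro d w hw hd
    refine (PowerSumsLE.card_exists_norm_lt hw hz hC hδ hδ1).trans ?_
    have hd2 : (d : ℝ) ≤ n := by exact_mod_cast hd
    rw [hδd, inv_inv, ← pow_mul]
    push_cast
    calc (d : ℝ) * (4 * ((n : ℝ) ^ 2)⁻¹ * (2 * (n : ℝ) ^ (2 * κ + 2)) +
          8 * C * κ.factorial * (n : ℝ) ^ (2 * κ))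
        ≤ n * (4 * ((n : ℝ) ^ 2)⁻¹ * (2 * (n : ℝ) ^ (2 * κ + 2)) +
          8 * C * κ.factorial * (n : ℝ) ^ (2 * κ)) := by gcongr
      _ = (8 + 8 * C * κ.factorial) * (n : ℝ) ^ (2 * κ + 1) := by
          field_simp
          ring
      _ ≤ _ := by
          gcongr
          linarith
  have h1 := hb hw hd
  have h2 := hb hw' hd'
  have h3 : 2 * (4 + 8 * C * κ.factorial) * (n : ℝ) ^ (2 * κ + 1) < (n : ℝ) ^ (2 * κ + 2) := by
    rw [pow_succ _ (2 * κ + 1), mul_comm]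
    gcongr
  linarith


/-- The power series `-X P' / P`, whose coefficients are the power sums of the inverse roots. -/
def powerSumSeries (P : PowerSeries ℂ) : PowerSeries ℂ :=
  -(PowerSeries.X * PowerSeries.derivative ℂ P) * P⁻¹

theorem mul_powerSumSeries {P : PowerSeries ℂ} (hP : PowerSeries.constantCoeff P = 1) :
    P * powerSumSeries P = -(PowerSeries.X * PowerSeries.derivative ℂ P) := by
  rw [powerSumSeries, mul_left_comm, PowerSeries.mul_inv_cancel _ (by simp [hP]), mul_one]

theorem powerSumSeries_eq_of_mul_eq {P G : PowerSeries ℂ} (hP : PowerSeries.constantCoeff P = 1)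
    (h : P * G = -(PowerSeries.X * PowerSeries.derivative ℂ P)) : powerSumSeries P = G := by
  rw [powerSumSeries, ← h, mul_right_comm, PowerSeries.mul_inv_cancel _ (by simp [hP]), one_mul]

theorem powerSumSeries_mul {P Q : PowerSeries ℂ} (hP : PowerSeries.constantCoeff P = 1)
    (hQ : PowerSeries.constantCoeff Q = 1) :
    powerSumSeries (P * Q) = powerSumSeries P + powerSumSeries Q := by
  refine powerSumSeries_eq_of_mul_eq (by simp [hP, hQ]) ?_
  have h1 := mul_powerSumSeries hP
  have h2 := mul_powerSumSeries hQ
  rw [Derivation.leibniz, smul_eq_mul, smul_eq_mul]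
  linear_combination Q * h1 + P * h2

theorem powerSumSeries_rescale {P : PowerSeries ℂ} (hP : PowerSeries.constantCoeff P = 1)
    (v : ℂ) : powerSumSeries (PowerSeries.rescale v P)
      = PowerSeries.rescale v (powerSumSeries P) := by
  refine powerSumSeries_eq_of_mul_eq ?_ ?_
  · rw [← PowerSeries.coeff_zero_eq_constantCoeff_apply, PowerSeries.coeff_rescale]
    simp [hP]
  · rw [← map_mul, mul_powerSumSeries hP]
    ext n
    rw [PowerSeries.coeff_rescale]
    rcases n with _ | n
    · simp
    · simp only [map_neg, PowerSeries.coeff_succ_X_mul, PowerSeries.coeff_derivative,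
        PowerSeries.coeff_rescale]
      ring

theorem coeff_powerSumSeries_congr {P Q : PowerSeries ℂ} {k : ℕ}
    (hP : PowerSeries.constantCoeff P = 1) (hQ : PowerSeries.constantCoeff Q = 1)
    (h : PowerSeries.X ^ (k + 1) ∣ P - Q) {m : ℕ} (hm : m ≤ k) :
    PowerSeries.coeff m (powerSumSeries P) = PowerSeries.coeff m (powerSumSeries Q) := by
  have h1 := mul_powerSumSeries hP
  have h2 := mul_powerSumSeries hQ
  have h3 : PowerSeries.X ^ (k + 1) ∣
      PowerSeries.X * PowerSeries.derivative ℂ P - PowerSeries.X * PowerSeries.derivative ℂ Q := by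
    rw [PowerSeries.X_pow_dvd_iff] at h ⊢
    intro n hn
    rcases n with _ | n
    · simp
    · have := h (n + 1) hn
      rw [map_sub, sub_eq_zero] at this
      simp [PowerSeries.coeff_succ_X_mul, PowerSeries.coeff_derivative, this]
  have h4 : PowerSeries.X ^ (k + 1) ∣ P * (powerSumSeries P - powerSumSeries Q) := by
    have : P * (powerSumSeries P - powerSumSeries Q) =
        -(PowerSeries.X * PowerSeries.derivative ℂ P - PowerSeries.X * PowerSeries.derivative ℂ Q)
          - (P - Q) * powerSumSeries Q := by
      linear_combination h1 - h2
    rw [this]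
    exact dvd_sub ((dvd_neg).2 h3) (h.mul_right _)
  have h5 : PowerSeries.X ^ (k + 1) ∣ powerSumSeries P - powerSumSeries Q := by
    have := h4.mul_left P⁻¹
    rwa [← mul_assoc, PowerSeries.inv_mul_cancel _ (by simp [hP]), one_mul] at this
  have h6 := PowerSeries.X_pow_dvd_iff.1 h5 m (by omega)
  rwa [map_sub, sub_eq_zero] at h6

theorem powerSumSeries_one_sub (w : ℂ) :
    powerSumSeries (1 - PowerSeries.C w * PowerSeries.X) =
      PowerSeries.mk fun m => if m = 0 then 0 else w ^ m := by
  refine powerSumSeries_eq_of_mul_eq (by simp) ?_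
  ext n
  rcases n with _ | n
  · simp
  · have : PowerSeries.derivative ℂ (1 - PowerSeries.C w * PowerSeries.X) = - PowerSeries.C w := by
      ext j
      simp only [PowerSeries.coeff_derivative, map_sub, map_neg, PowerSeries.coeff_C,
        PowerSeries.coeff_C_mul, PowerSeries.coeff_one, PowerSeries.coeff_X]
      rcases j with _ | j <;> simp
    rw [this, sub_mul, one_mul, mul_assoc, map_sub, PowerSeries.coeff_C_mul,
      PowerSeries.coeff_succ_X_mul, PowerSeries.coeff_mk, PowerSeries.coeff_mk, map_neg,
      PowerSeries.coeff_succ_X_mul, map_neg, PowerSeries.coeff_C]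
    rcases n with _ | n
    · simp
    · simp; ring

theorem powerSumSeries_prod {ι : Type*} (s : Finset ι) (w : ι → ℂ) :
    PowerSeries.constantCoeff (∏ i ∈ s, (1 - PowerSeries.C (w i) * PowerSeries.X)) = 1 ∧
    powerSumSeries (∏ i ∈ s, (1 - PowerSeries.C (w i) * PowerSeries.X)) =
      ∑ i ∈ s, powerSumSeries (1 - PowerSeries.C (w i) * PowerSeries.X) := by
  classical
  induction s using Finset.induction_on with
  | empty => simp [powerSumSeries]
  | insert a s ha ih =>
    have h1 : PowerSeries.constantCoeff (1 - PowerSeries.C (w a) * PowerSeries.X) = 1 := by simp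
    rw [Finset.prod_insert ha, Finset.sum_insert ha, powerSumSeries_mul h1 ih.1, ih.2, map_mul, h1,
      ih.1]
    simp

theorem coeff_powerSumSeries_prod {d : ℕ} (w : Fin d → ℂ) {m : ℕ} (hm : 1 ≤ m) :
    PowerSeries.coeff m (powerSumSeries (∏ i, (1 - PowerSeries.C (w i) * PowerSeries.X))) =
      ∑ i, w i ^ m := by
  rw [(powerSumSeries_prod _ _).2, map_sum]
  refine Finset.sum_congr rfl fun i _ => ?_
  rw [powerSumSeries_one_sub, PowerSeries.coeff_mk, if_neg (by omega)]

/-- A complex polynomial with constant coefficient `1` factors through its inverse roots. -/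
theorem exists_inverse_roots (P : Polynomial ℂ) (hP : P.coeff 0 = 1) :
    ∃ (d : ℕ) (w : Fin d → ℂ), d = P.natDegree ∧ (∀ i, w i ≠ 0) ∧
      P = ∏ i, (1 - Polynomial.C (w i) * Polynomial.X) := by
  have hs := IsAlgClosed.splits P
  have hP0 : P ≠ 0 := by rintro rfl; simp at hP
  have hroot : ∀ x ∈ P.roots, x ≠ 0 := by
    rintro x hx rfl
    have := (Polynomial.mem_roots hP0).1 hx
    rw [Polynomial.IsRoot.def, ← Polynomial.coeff_zero_eq_eval_zero, hP] at this
    exact one_ne_zero this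
  have h1 : P = Polynomial.C P.leadingCoeff *
      (Polynomial.C (P.roots.map fun x => -x).prod *
        (P.roots.map fun x => 1 - Polynomial.C x⁻¹ * Polynomial.X).prod) := by
    conv_lhs => rw [hs.eq_prod_roots]
    congr 1
    rw [← Multiset.prod_hom (P.roots.map fun x => -x) (Polynomial.C : ℂ →+* _), Multiset.map_map,
      ← Multiset.prod_map_mul]
    congr 1
    refine Multiset.map_congr rfl fun x hx => ?_
    have hx0 := hroot x hx
    have : Polynomial.C x * Polynomial.C x⁻¹ = (1 : Polynomial ℂ) := by
      rw [← Polynomial.C_mul, mul_inv_cancel₀ hx0, Polynomial.C_1]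
    simp only [Function.comp, Polynomial.C_neg]
    linear_combination (-Polynomial.X) * this
  have h2 : P = (P.roots.map fun x => 1 - Polynomial.C x⁻¹ * Polynomial.X).prod := by
    have h3 : P.leadingCoeff * (P.roots.map fun x => -x).prod = 1 := by
      have := congrArg (fun Q => Polynomial.eval 0 Q) h1
      simp only [Polynomial.eval_mul, Polynomial.eval_C, Polynomial.eval_multiset_prod,
        Multiset.map_map, Function.comp, Polynomial.eval_sub, Polynomial.eval_one,
        Polynomial.eval_X, mul_zero, sub_zero, Multiset.map_const', Multiset.prod_replicate,
        one_pow, mul_one] at this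
      rw [← this, ← Polynomial.coeff_zero_eq_eval_zero, hP]
    conv_lhs => rw [h1]
    rw [← mul_assoc, ← Polynomial.C_mul, h3, Polynomial.C_1, one_mul]
  refine ⟨P.roots.toList.length, fun i => (P.roots.toList.get i)⁻¹, ?_, fun i => ?_, ?_⟩
  · rw [Multiset.length_toList, hs.natDegree_eq_card_roots]
  · exact inv_ne_zero (hroot _ (by rw [← Multiset.mem_toList]; exact List.get_mem _ _))
  · conv_lhs => rw [h2, ← Multiset.coe_toList P.roots, Multiset.map_coe, Multiset.prod_coe]
    rw [← List.prod_ofFn]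
    congr 1
    have h3 := List.map_ofFn (f := P.roots.toList.get)
      (g := fun x => 1 - Polynomial.C x⁻¹ * Polynomial.X)
    rw [List.ofFn_get] at h3
    exact h3

/-- The Szegő recursion for the monic orthogonal polynomials and their reversals. -/
def szego (a : ℕ → ℂ) : ℕ → Polynomial ℂ × Polynomial ℂ
  | 0 => (1, 1)
  | k + 1 => (Polynomial.X * (szego a k).1 - Polynomial.C (conj (a k)) * (szego a k).2,
      (szego a k).2 - Polynomial.C (a k) * (Polynomial.X * (szego a k).1))

/-- The reversed polynomial after one more Szegő step with coefficient `γ`. -/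
def szegoStep (a : ℕ → ℂ) (k : ℕ) (γ : ℂ) : Polynomial ℂ :=
  (szego a k).2 - Polynomial.C γ * (Polynomial.X * (szego a k).1)

theorem szegoStep_self (a : ℕ → ℂ) (k : ℕ) : szegoStep a k (a k) = (szego a (k + 1)).2 := rfl

theorem norm_sq_szego_identity (a b c : ℂ) :
    ‖b - a * c‖ ^ 2 - ‖c - conj a * b‖ ^ 2 = (1 - ‖a‖ ^ 2) * (‖b‖ ^ 2 - ‖c‖ ^ 2) := by
  simp only [← Complex.normSq_eq_norm_sq, Complex.normSq_apply, Complex.sub_re, Complex.sub_im,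
    Complex.mul_re, Complex.mul_im, Complex.conj_re, Complex.conj_im]
  ring

theorem szego_natDegree_le (a : ℕ → ℂ) (k : ℕ) :
    (szego a k).1.natDegree ≤ k ∧ (szego a k).2.natDegree ≤ k := by
  induction k with
  | zero => simp [szego]
  | succ k ih =>
    have h1 : (Polynomial.X * (szego a k).1).natDegree ≤ k + 1 := by
      refine Polynomial.natDegree_mul_le.trans ?_
      rw [Polynomial.natDegree_X]; omega
    constructor
    · exact (Polynomial.natDegree_sub_le_of_le h1 ((Polynomial.natDegree_C_mul_le _ _).trans
        (ih.2.trans (Nat.le_succ k)))).trans (max_self _).le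
    · exact (Polynomial.natDegree_sub_le_of_le (ih.2.trans (Nat.le_succ k))
        ((Polynomial.natDegree_C_mul_le _ _).trans h1)).trans (max_self _).le

theorem szegoStep_natDegree_le (a : ℕ → ℂ) (k : ℕ) (γ : ℂ) :
    (szegoStep a k γ).natDegree ≤ k + 1 := by
  have h := szego_natDegree_le a k
  have h1 : (Polynomial.X * (szego a k).1).natDegree ≤ k + 1 := by
    refine Polynomial.natDegree_mul_le.trans ?_
    rw [Polynomial.natDegree_X]; omega
  exact (Polynomial.natDegree_sub_le_of_le (h.2.trans (Nat.le_succ k))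
    ((Polynomial.natDegree_C_mul_le _ _).trans h1)).trans (max_self _).le

theorem szego_coeff_self (a : ℕ → ℂ) (k : ℕ) : (szego a k).1.coeff k = 1 := by
  induction k with
  | zero => simp [szego]
  | succ k ih =>
    have h := (szego_natDegree_le a k).2
    simp only [szego, Polynomial.coeff_sub, Polynomial.coeff_X_mul, Polynomial.coeff_C_mul, ih]
    rw [Polynomial.coeff_eq_zero_of_natDegree_lt (Nat.lt_succ_of_le h)]
    simp

theorem szego_coeff_zero (a : ℕ → ℂ) (k : ℕ) : (szego a k).2.coeff 0 = 1 := by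
  induction k with
  | zero => simp [szego]
  | succ k ih => simp [szego, ih]

theorem szegoStep_coeff_zero (a : ℕ → ℂ) (k : ℕ) (γ : ℂ) : (szegoStep a k γ).coeff 0 = 1 := by
  simp [szegoStep, szego_coeff_zero]

theorem szegoStep_natDegree_eq (a : ℕ → ℂ) (k : ℕ) {γ : ℂ} (hγ : γ ≠ 0) :
    (szegoStep a k γ).natDegree = k + 1 := by
  refine le_antisymm (szegoStep_natDegree_le a k γ) (Polynomial.le_natDegree_of_ne_zero ?_)
  rw [szegoStep, Polynomial.coeff_sub, Polynomial.coeff_C_mul, Polynomial.coeff_X_mul,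
    szego_coeff_self, Polynomial.coeff_eq_zero_of_natDegree_lt
      (Nat.lt_succ_of_le (szego_natDegree_le a k).2)]
  simpa using hγ

theorem norm_eval_szego_of_norm_lt_one {a : ℕ → ℂ} (ha : ∀ k, ‖a k‖ < 1) {z : ℂ} (hz : ‖z‖ < 1)
    (k : ℕ) : 0 < ‖(szego a k).2.eval z‖ ∧ ‖(szego a k).1.eval z‖ ≤ ‖(szego a k).2.eval z‖ := by
  induction k with
  | zero => simp [szego]
  | succ k ih =>
    set b := (szego a k).2.eval z
    set c := z * (szego a k).1.eval z with hc
    have hcb : ‖c‖ ≤ ‖b‖ := by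
      rw [hc, norm_mul]
      exact (mul_le_of_le_one_left (norm_nonneg _) hz.le).trans ih.2
    have e1 : (szego a (k + 1)).1.eval z = c - conj (a k) * b := by simp [szego, b, hc]
    have e2 : (szego a (k + 1)).2.eval z = b - a k * c := by simp [szego, b, hc]
    rw [e1, e2]
    have hid := norm_sq_szego_identity (a k) b c
    have ha1 := ha k
    have ha0 := norm_nonneg (a k)
    constructor
    · have h1 := norm_sub_norm_le b (a k * c)
      rw [norm_mul] at h1
      have : ‖a k‖ * ‖c‖ ≤ ‖a k‖ * ‖b‖ := by gcongr
      have := mul_lt_of_lt_one_left ih.1 ha1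
      linarith
    · refine abs_le_of_sq_le_sq' ?_ (norm_nonneg _) |>.2
      have : 0 ≤ (1 - ‖a k‖ ^ 2) * (‖b‖ ^ 2 - ‖c‖ ^ 2) := by
        apply mul_nonneg
        · nlinarith
        · have := pow_le_pow_left₀ (norm_nonneg _) hcb 2
          linarith
      linarith

theorem norm_eval_szego_of_one_lt_norm {a : ℕ → ℂ} (ha : ∀ k, ‖a k‖ < 1) {z : ℂ} (hz : 1 < ‖z‖)
    (k : ℕ) : 0 < ‖(szego a k).1.eval z‖ ∧ ‖(szego a k).2.eval z‖ ≤ ‖(szego a k).1.eval z‖ := by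
  induction k with
  | zero => simp [szego]
  | succ k ih =>
    set b := (szego a k).2.eval z
    set c := z * (szego a k).1.eval z with hc
    have hcb : ‖b‖ ≤ ‖c‖ ∧ 0 < ‖c‖ := by
      rw [hc, norm_mul]
      exact ⟨ih.2.trans (le_mul_of_one_le_left (norm_nonneg _) hz.le),
        mul_pos (by linarith) ih.1⟩
    have e1 : (szego a (k + 1)).1.eval z = c - conj (a k) * b := by simp [szego, b, hc]
    have e2 : (szego a (k + 1)).2.eval z = b - a k * c := by simp [szego, b, hc]
    rw [e1, e2]
    have hid := norm_sq_szego_identity (a k) b c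
    have ha1 := ha k
    have ha0 := norm_nonneg (a k)
    constructor
    · have h1 := norm_sub_norm_le c (conj (a k) * b)
      rw [norm_mul (conj (a k)) b, RCLike.norm_conj] at h1
      have : ‖a k‖ * ‖b‖ ≤ ‖a k‖ * ‖c‖ := by gcongr; exact hcb.1
      have := mul_lt_of_lt_one_left hcb.2 ha1
      linarith
    · refine abs_le_of_sq_le_sq' ?_ (norm_nonneg _) |>.2
      have : 0 ≤ (1 - ‖a k‖ ^ 2) * (‖c‖ ^ 2 - ‖b‖ ^ 2) := by
        apply mul_nonneg
        · nlinarith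
        · have := pow_le_pow_left₀ (norm_nonneg _) hcb.1 2
          linarith
      linarith

theorem norm_eval_szego_of_norm_eq_one (a : ℕ → ℂ) {z : ℂ} (hz : ‖z‖ = 1) (k : ℕ) :
    ‖(szego a k).1.eval z‖ = ‖(szego a k).2.eval z‖ := by
  induction k with
  | zero => simp [szego]
  | succ k ih =>
    set b := (szego a k).2.eval z
    set c := z * (szego a k).1.eval z with hc
    have hcb : ‖c‖ = ‖b‖ := by rw [hc, norm_mul, hz, one_mul, ih]
    have e1 : (szego a (k + 1)).1.eval z = c - conj (a k) * b := by simp [szego, b, hc]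
    have e2 : (szego a (k + 1)).2.eval z = b - a k * c := by simp [szego, b, hc]
    rw [e1, e2]
    have hid := norm_sq_szego_identity (a k) b c
    rw [hcb, sub_self, mul_zero, sub_eq_zero] at hid
    exact ((pow_left_inj₀ (norm_nonneg _) (norm_nonneg _) two_ne_zero).1 hid).symm

theorem eval_szegoStep_ne_zero {a : ℕ → ℂ} (ha : ∀ k, ‖a k‖ < 1) {γ : ℂ} (hγ : ‖γ‖ ≤ 1) {z : ℂ}
    (hz : ‖z‖ < 1) (k : ℕ) : (szegoStep a k γ).eval z ≠ 0 := by
  obtain ⟨h1, h2⟩ := norm_eval_szego_of_norm_lt_one ha hz k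
  simp only [szegoStep, Polynomial.eval_sub, Polynomial.eval_mul, Polynomial.eval_C,
    Polynomial.eval_X]
  rw [sub_ne_zero]
  intro h
  have h3 := congrArg norm h
  rw [norm_mul, norm_mul] at h3
  have h4 : ‖z‖ * ‖(szego a k).1.eval z‖ ≤ ‖z‖ * ‖(szego a k).2.eval z‖ := by gcongr
  have h5 : ‖γ‖ * (‖z‖ * ‖(szego a k).1.eval z‖) ≤ ‖z‖ * ‖(szego a k).1.eval z‖ :=
    mul_le_of_le_one_left (by positivity) hγ
  have := mul_lt_of_lt_one_left h1 hz
  linarith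

theorem eval_szegoStep_ne_zero_of_one_lt {a : ℕ → ℂ} (ha : ∀ k, ‖a k‖ < 1) {γ : ℂ} (hγ : ‖γ‖ = 1)
    {z : ℂ} (hz : 1 < ‖z‖) (k : ℕ) : (szegoStep a k γ).eval z ≠ 0 := by
  obtain ⟨h1, h2⟩ := norm_eval_szego_of_one_lt_norm ha hz k
  simp only [szegoStep, Polynomial.eval_sub, Polynomial.eval_mul, Polynomial.eval_C,
    Polynomial.eval_X]
  rw [sub_ne_zero]
  intro h
  have h3 := congrArg norm h
  rw [norm_mul, norm_mul, hγ, one_mul] at h3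
  have := lt_mul_of_one_lt_left h1 hz
  linarith

theorem coe_prod_inverse_roots {d : ℕ} (w : Fin d → ℂ) :
    ((∏ i, (1 - Polynomial.C (w i) * Polynomial.X) : Polynomial ℂ) : PowerSeries ℂ) =
      ∏ i, (1 - PowerSeries.C (w i) * PowerSeries.X) := by
  rw [← Polynomial.coeToPowerSeries.ringHom_apply, map_prod]
  simp

theorem coeff_powerSumSeries_coe_prod {d : ℕ} (w : Fin d → ℂ) {m : ℕ} (hm : 1 ≤ m) :
    PowerSeries.coeff m (powerSumSeries
      ((∏ i, (1 - Polynomial.C (w i) * Polynomial.X) : Polynomial ℂ) : PowerSeries ℂ)) =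
      ∑ i, w i ^ m := by
  rw [coe_prod_inverse_roots, coeff_powerSumSeries_prod w hm]

theorem eval_prod_inverse_roots {d : ℕ} (w : Fin d → ℂ) (z : ℂ) :
    (∏ i, (1 - Polynomial.C (w i) * Polynomial.X) : Polynomial ℂ).eval z = ∏ i, (1 - z * w i) := by
  rw [Polynomial.eval_prod]
  refine Finset.prod_congr rfl fun i _ => ?_
  rw [Polynomial.eval_sub, Polynomial.eval_one, Polynomial.eval_C_mul, Polynomial.eval_X,
    mul_comm]

theorem norm_inverse_root_le {d : ℕ} {w : Fin d → ℂ} (hw : ∀ i, w i ≠ 0)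
    (h : ∀ z : ℂ, ‖z‖ < 1 →
      (∏ i, (1 - Polynomial.C (w i) * Polynomial.X) : Polynomial ℂ).eval z ≠ 0) (i : Fin d) :
    ‖w i‖ ≤ 1 := by
  by_contra! hi
  refine h (w i)⁻¹ ?_ ?_
  · rw [norm_inv]; exact inv_lt_one_of_one_lt₀ hi
  · rw [eval_prod_inverse_roots]
    exact Finset.prod_eq_zero (Finset.mem_univ i) (by rw [inv_mul_cancel₀ (hw i), sub_self])

theorem norm_inverse_root_ge {d : ℕ} {w : Fin d → ℂ} (hw : ∀ i, w i ≠ 0)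
    (h : ∀ z : ℂ, 1 < ‖z‖ →
      (∏ i, (1 - Polynomial.C (w i) * Polynomial.X) : Polynomial ℂ).eval z ≠ 0) (i : Fin d) :
    1 ≤ ‖w i‖ := by
  by_contra! hi
  refine h (w i)⁻¹ ?_ ?_
  · rw [norm_inv]; exact (one_lt_inv₀ (norm_pos_iff.2 (hw i))).2 hi
  · rw [eval_prod_inverse_roots]
    exact Finset.prod_eq_zero (Finset.mem_univ i) (by rw [inv_mul_cancel₀ (hw i), sub_self])

/-- A polynomial without zeros in the open disc has power sums bounded by its degree. -/
theorem norm_coeff_powerSumSeries_le {P : Polynomial ℂ} (hP : P.coeff 0 = 1)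
    (h : ∀ z : ℂ, ‖z‖ < 1 → P.eval z ≠ 0) {m : ℕ} (hm : 1 ≤ m) :
    ‖PowerSeries.coeff m (powerSumSeries (P : PowerSeries ℂ))‖ ≤ P.natDegree := by
  obtain ⟨d, w, hd, hw0, hw⟩ := exists_inverse_roots P hP
  have h1 := norm_inverse_root_le hw0 (hw ▸ h)
  rw [← hd, hw, coeff_powerSumSeries_coe_prod w hm]
  calc ‖∑ i, w i ^ m‖ ≤ ∑ _i : Fin d, (1 : ℝ) := norm_sum_le_of_le _ fun i _ => by
        rw [norm_pow]; exact pow_le_one₀ (norm_nonneg _) (h1 i)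
    _ = d := by rw [Finset.sum_const, Finset.card_univ, Fintype.card_fin, nsmul_one]

/-- The difference of the `m`-th power sums of `szegoStep a k γ` and of `(szego a k).2`. -/
def powerSumIncrement (a : ℕ → ℂ) (m k : ℕ) (γ : ℂ) : ℂ :=
  PowerSeries.coeff m (powerSumSeries (szegoStep a k γ : PowerSeries ℂ)) -
    PowerSeries.coeff m (powerSumSeries ((szego a k).2 : PowerSeries ℂ))

theorem norm_powerSum_szego_le {a : ℕ → ℂ} (ha : ∀ k, ‖a k‖ < 1) {m : ℕ} (hm : 1 ≤ m) (k : ℕ) :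
    ‖PowerSeries.coeff m (powerSumSeries ((szego a k).2 : PowerSeries ℂ))‖ ≤ k := by
  refine (norm_coeff_powerSumSeries_le (szego_coeff_zero a k)
    (fun z hz => norm_pos_iff.1 (norm_eval_szego_of_norm_lt_one ha hz k).1) hm).trans ?_
  exact_mod_cast (szego_natDegree_le a k).2

theorem norm_powerSumIncrement_le_of_index {a : ℕ → ℂ} (ha : ∀ k, ‖a k‖ < 1) {m : ℕ} (hm : 1 ≤ m)
    (k : ℕ) {γ : ℂ} (hγ : ‖γ‖ ≤ 1) : ‖powerSumIncrement a m k γ‖ ≤ 2 * k + 1 := by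
  have h1 := norm_coeff_powerSumSeries_le (szegoStep_coeff_zero a k γ)
    (fun z hz => eval_szegoStep_ne_zero ha hγ hz k) hm
  have h2 : ((szegoStep a k γ).natDegree : ℝ) ≤ k + 1 := by
    exact_mod_cast szegoStep_natDegree_le a k γ
  have h3 := norm_powerSum_szego_le ha hm k
  refine (norm_sub_le _ _).trans ?_
  linarith

theorem constantCoeff_coe {P : Polynomial ℂ} (hP : P.coeff 0 = 1) :
    PowerSeries.constantCoeff (P : PowerSeries ℂ) = 1 := by
  rw [← PowerSeries.coeff_zero_eq_constantCoeff_apply, Polynomial.coeff_coe, hP]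

theorem constantCoeff_rescale_coe {P : Polynomial ℂ} (hP : P.coeff 0 = 1) (v : ℂ) :
    PowerSeries.constantCoeff (PowerSeries.rescale v (P : PowerSeries ℂ)) = 1 := by
  rw [← PowerSeries.coeff_zero_eq_constantCoeff_apply, PowerSeries.coeff_rescale,
    Polynomial.coeff_coe, hP]
  simp

/-- Wronskian of a shifted and a rotated solution of the Szegő recursion, when the shift acts on
the coefficients as a rotation. -/
theorem pow_dvd_szego_wronskian {a : ℕ → ℂ} {u v : ℂ} (hu : ‖u‖ = 1) (hv : ‖v‖ = 1)
    (ha : ∀ k, a (k + 1) = u * v ^ k * a k) (k : ℕ) :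
    (PowerSeries.X : PowerSeries ℂ) ^ k ∣
      ((szego a (k + 1)).1 : PowerSeries ℂ) * PowerSeries.rescale v ((szego a k).2 : PowerSeries ℂ)
        - PowerSeries.C (v * (u * v ^ k)⁻¹) *
          PowerSeries.rescale v ((szego a k).1 : PowerSeries ℂ) * ((szego a (k + 1)).2 :
            PowerSeries ℂ) := by
  have hu0 : u ≠ 0 := norm_ne_zero_iff.1 (by rw [hu]; exact one_ne_zero)
  have hv0 : v ≠ 0 := norm_ne_zero_iff.1 (by rw [hv]; exact one_ne_zero)
  have hconj : ∀ x : ℂ, ‖x‖ = 1 → conj x = x⁻¹ := fun x hx => by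
    rw [Complex.inv_def, Complex.normSq_eq_norm_sq, hx]; simp
  induction k with
  | zero => simp
  | succ k ih =>
    set p := ((szego a (k + 1)).1 : PowerSeries ℂ)
    set q := ((szego a (k + 1)).2 : PowerSeries ℂ)
    set p' := PowerSeries.rescale v ((szego a k).1 : PowerSeries ℂ) with hp'
    set q' := PowerSeries.rescale v ((szego a k).2 : PowerSeries ℂ) with hq'
    set A := PowerSeries.C (a (k + 1))
    set B := PowerSeries.C (conj (a (k + 1)))
    set g := PowerSeries.C (v * (u * v ^ k)⁻¹)
    have e1 : ((szego a (k + 1 + 1)).1 : PowerSeries ℂ) = PowerSeries.X * p - B * q := by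
      rw [szego]; simp [p, q, B]
    have e2 : ((szego a (k + 1 + 1)).2 : PowerSeries ℂ) = q - A * (PowerSeries.X * p) := by
      rw [szego]; simp [p, q, A]
    have hX : PowerSeries.rescale v (PowerSeries.X : PowerSeries ℂ) =
        PowerSeries.C v * PowerSeries.X := PowerSeries.rescale_X v
    have hC : ∀ c : ℂ, PowerSeries.rescale v (PowerSeries.C c) = PowerSeries.C c := fun c => by
      ext n
      rw [PowerSeries.coeff_rescale, PowerSeries.coeff_C]
      split_ifs with h <;> simp [h]
    have hak : conj (a (k + 1)) = (u * v ^ k)⁻¹ * conj (a k) := by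
      rw [ha, map_mul, hconj (u * v ^ k) (by rw [norm_mul, norm_pow, hu, hv]; simp)]
    have e3 : PowerSeries.C (v * (u * v ^ (k + 1))⁻¹) *
        PowerSeries.rescale v ((szego a (k + 1)).1 : PowerSeries ℂ) =
        PowerSeries.X * (g * p') - B * q' := by
      have : ((szego a (k + 1)).1 : PowerSeries ℂ) = PowerSeries.X * ((szego a k).1 : PowerSeries ℂ)
          - PowerSeries.C (conj (a k)) * ((szego a k).2 : PowerSeries ℂ) := by
        rw [szego]; simp
      rw [this, map_sub (PowerSeries.rescale v), map_mul (PowerSeries.rescale v),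
        map_mul (PowerSeries.rescale v), hX, hC, ← hp', ← hq']
      have h1 : PowerSeries.C (v * (u * v ^ (k + 1))⁻¹) * PowerSeries.C v = g := by
        rw [← map_mul]; congr 1; field_simp; ring
      have h2 : PowerSeries.C (v * (u * v ^ (k + 1))⁻¹) * PowerSeries.C (conj (a k)) = B := by
        change _ = PowerSeries.C (conj (a (k + 1)))
        rw [← map_mul, hak]; congr 1; field_simp; ring
      linear_combination PowerSeries.X * p' * h1 - q' * h2
    have e4 : PowerSeries.rescale v ((szego a (k + 1)).2 : PowerSeries ℂ) =
        q' - A * (PowerSeries.X * (g * p')) := by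
      have : ((szego a (k + 1)).2 : PowerSeries ℂ) = ((szego a k).2 : PowerSeries ℂ)
          - PowerSeries.C (a k) * (PowerSeries.X * ((szego a k).1 : PowerSeries ℂ)) := by
        rw [szego]; simp
      rw [this, map_sub (PowerSeries.rescale v), map_mul (PowerSeries.rescale v),
        map_mul (PowerSeries.rescale v), hX, hC, ← hp', ← hq']
      have h1 : A * g = PowerSeries.C (a k) * PowerSeries.C v := by
        rw [← map_mul, ← map_mul]; congr 1; rw [ha]; field_simp
      linear_combination PowerSeries.X * p' * h1
    rw [e1, e2, e3, e4]
    obtain ⟨c, hc⟩ := ih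
    refine ⟨(1 - A * B) * c, ?_⟩
    rw [pow_succ]
    linear_combination PowerSeries.X * (1 - A * B) * hc

theorem powerSumIncrement_succ {a : ℕ → ℂ} {u v : ℂ} (hu : ‖u‖ = 1) (hv : ‖v‖ = 1)
    (ha : ∀ k, a (k + 1) = u * v ^ k * a k) {m k : ℕ} (hmk : m ≤ k) (γ : ℂ) :
    powerSumIncrement a m (k + 1) γ =
      v ^ m * powerSumIncrement a m k (γ * (u * v ^ k)⁻¹) := by
  have hu0 : u ≠ 0 := norm_ne_zero_iff.1 (by rw [hu]; exact one_ne_zero)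
  have hv0 : v ≠ 0 := norm_ne_zero_iff.1 (by rw [hv]; exact one_ne_zero)
  set γ' := γ * (u * v ^ k)⁻¹ with hγ'
  have h0 := constantCoeff_coe (szegoStep_coeff_zero a (k + 1) γ)
  have h1 := constantCoeff_rescale_coe (szego_coeff_zero a k) v
  have h2 := constantCoeff_coe (szego_coeff_zero a (k + 1))
  have h3 := constantCoeff_rescale_coe (szegoStep_coeff_zero a k γ') v
  have hdvd : (PowerSeries.X : PowerSeries ℂ) ^ (k + 1) ∣
      (szegoStep a (k + 1) γ : PowerSeries ℂ) *
        PowerSeries.rescale v ((szego a k).2 : PowerSeries ℂ) -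
      ((szego a (k + 1)).2 : PowerSeries ℂ) *
        PowerSeries.rescale v (szegoStep a k γ' : PowerSeries ℂ) := by
    obtain ⟨c, hc⟩ := pow_dvd_szego_wronskian hu hv ha k
    refine ⟨-(PowerSeries.C γ * c), ?_⟩
    have e1 : ∀ k γ, (szegoStep a k γ : PowerSeries ℂ) = ((szego a k).2 : PowerSeries ℂ) -
        PowerSeries.C γ * (PowerSeries.X * ((szego a k).1 : PowerSeries ℂ)) := fun k γ => by
      simp [szegoStep]
    have hC : ∀ c : ℂ, PowerSeries.rescale v (PowerSeries.C c) = PowerSeries.C c := fun c => by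
      ext n
      rw [PowerSeries.coeff_rescale, PowerSeries.coeff_C]
      split_ifs with h <;> simp [h]
    have h4 : PowerSeries.C γ' * PowerSeries.C v =
        PowerSeries.C γ * PowerSeries.C (v * (u * v ^ k)⁻¹) := by
      rw [← map_mul, ← map_mul]; congr 1; rw [hγ']; ring
    rw [e1, e1, map_sub (PowerSeries.rescale v), map_mul (PowerSeries.rescale v),
      map_mul (PowerSeries.rescale v), PowerSeries.rescale_X, hC, pow_succ]
    linear_combination (-PowerSeries.C γ * PowerSeries.X) * hc +
      ((szego a (k + 1)).2 : PowerSeries ℂ) * PowerSeries.X *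
        PowerSeries.rescale v ((szego a k).1 : PowerSeries ℂ) * h4
  have h4 := coeff_powerSumSeries_congr (by rw [map_mul, h0, h1, mul_one])
    (by rw [map_mul, h2, h3, mul_one]) hdvd hmk
  rw [powerSumSeries_mul h0 h1, powerSumSeries_mul h2 h3,
    powerSumSeries_rescale (constantCoeff_coe (szego_coeff_zero a k)),
    powerSumSeries_rescale (constantCoeff_coe (szegoStep_coeff_zero a k γ')),
    map_add, map_add, PowerSeries.coeff_rescale, PowerSeries.coeff_rescale] at h4
  rw [powerSumIncrement, powerSumIncrement]
  linear_combination h4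

theorem norm_powerSumIncrement_le {a : ℕ → ℂ} (ha1 : ∀ k, ‖a k‖ < 1) {u v : ℂ} (hu : ‖u‖ = 1)
    (hv : ‖v‖ = 1) (ha : ∀ k, a (k + 1) = u * v ^ k * a k) {m : ℕ} (hm : 1 ≤ m) (k : ℕ) :
    ∀ γ : ℂ, ‖γ‖ ≤ 1 → ‖powerSumIncrement a m k γ‖ ≤ 2 * m + 1 := by
  induction k with
  | zero =>
    intro γ hγ
    refine (norm_powerSumIncrement_le_of_index ha1 hm 0 hγ).trans ?_
    simp
  | succ k ih =>
    intro γ hγ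
    rcases Nat.lt_or_ge k m with hk | hk
    · refine (norm_powerSumIncrement_le_of_index ha1 hm (k + 1) hγ).trans ?_
      have : ((k + 1 : ℕ) : ℝ) ≤ m := by exact_mod_cast hk
      linarith
    · rw [powerSumIncrement_succ hu hv ha hk, norm_mul, norm_pow, hv, one_pow, one_mul]
      refine ih _ ?_
      rw [norm_mul, norm_inv, norm_mul, norm_pow, hu, hv]
      simpa using hγ

theorem powerSumIncrement_self_add {a : ℕ → ℂ} {u v : ℂ} (hu : ‖u‖ = 1) (hv : ‖v‖ = 1)
    (ha : ∀ k, a (k + 1) = u * v ^ k * a k) (m j : ℕ) :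
    powerSumIncrement a m (m + j) (a (m + j)) =
      (v ^ m) ^ j * powerSumIncrement a m m (a m) := by
  have hu0 : u ≠ 0 := norm_ne_zero_iff.1 (by rw [hu]; exact one_ne_zero)
  have hv0 : v ≠ 0 := norm_ne_zero_iff.1 (by rw [hv]; exact one_ne_zero)
  induction j with
  | zero => simp
  | succ j ih =>
    have : a (m + (j + 1)) * (u * v ^ (m + j))⁻¹ = a (m + j) := by
      rw [← add_assoc, ha]; field_simp
    rw [← add_assoc, powerSumIncrement_succ hu hv ha (Nat.le_add_right m j), add_assoc, this, ih]
    ring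

theorem norm_powerSum_szego_le_div {a : ℕ → ℂ} (ha1 : ∀ k, ‖a k‖ < 1) {u v : ℂ} (hu : ‖u‖ = 1)
    (hv : ‖v‖ = 1) (ha : ∀ k, a (k + 1) = u * v ^ k * a k) {m : ℕ} (hm : 1 ≤ m)
    (hvm : v ^ m ≠ 1) (k : ℕ) :
    ‖PowerSeries.coeff m (powerSumSeries ((szego a k).2 : PowerSeries ℂ))‖ ≤
      m + (2 * m + 1) * (2 / ‖v ^ m - 1‖) := by
  have hpos : 0 < ‖v ^ m - 1‖ := norm_pos_iff.2 (sub_ne_zero.2 hvm)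
  rcases Nat.lt_or_ge k m with hk | hk
  · refine (norm_powerSum_szego_le ha1 hm k).trans ?_
    have : (k : ℝ) ≤ m := by exact_mod_cast hk.le
    have : 0 ≤ (2 * (m : ℝ) + 1) * (2 / ‖v ^ m - 1‖) := by positivity
    linarith
  · obtain ⟨j, rfl⟩ := Nat.exists_eq_add_of_le hk
    have h1 : PowerSeries.coeff m (powerSumSeries ((szego a (m + j)).2 : PowerSeries ℂ)) =
        PowerSeries.coeff m (powerSumSeries ((szego a m).2 : PowerSeries ℂ)) +
          (∑ i ∈ Finset.range j, (v ^ m) ^ i) * powerSumIncrement a m m (a m) := by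
      clear hk
      induction j with
      | zero => simp
      | succ j ih =>
        have := powerSumIncrement_self_add hu hv ha m j
        rw [powerSumIncrement, szegoStep_self] at this
        rw [Finset.sum_range_succ, ← add_assoc]
        linear_combination this + ih
    rw [h1, geom_sum_eq hvm]
    refine (norm_add_le _ _).trans (add_le_add (norm_powerSum_szego_le ha1 hm m) ?_)
    rw [norm_mul, norm_div, mul_comm]
    refine mul_le_mul (norm_powerSumIncrement_le ha1 hu hv ha hm m _ (ha1 m).le) ?_
      (by positivity) (by positivity)
    gcongr
    refine (norm_sub_le _ _).trans ?_
    rw [norm_pow, norm_pow, hv]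
    norm_num

/-- A small divisor condition, in the form in which it bounds the power sums of the inverse roots of
Szegő polynomials. -/
def SmallDivisors (C : ℝ) (κ : ℕ) (v : ℂ) : Prop :=
  ∀ m : ℕ, 1 ≤ m → v ^ m ≠ 1 ∧
    (m : ℝ) + (2 * m + 1) * (2 / ‖v ^ m - 1‖) + (2 * m + 1) ≤ C * (m : ℝ) ^ κ

theorem e_add (s t : ℝ) : e (s + t) = e s * e t := by
  rw [e, e, e, ← Complex.exp_add]
  congr 1
  push_cast
  ring

theorem e_eq_exp_mul_I (t : ℝ) : e t = Complex.exp ((2 * Real.pi * t : ℝ) * Complex.I) := by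
  rw [e]
  congr 1
  push_cast
  ring

theorem norm_e (t : ℝ) : ‖e t‖ = 1 := by
  rw [e_eq_exp_mul_I, Complex.norm_exp_ofReal_mul_I]

theorem e_neg (t : ℝ) : e (-t) = conj (e t) := by
  rw [e_eq_exp_mul_I, e_eq_exp_mul_I, ← Complex.exp_conj, map_mul, Complex.conj_I,
    Complex.conj_ofReal]
  congr 1
  push_cast
  ring

theorem e_nat_mul (m : ℕ) (t : ℝ) : e (m * t) = e t ^ m := by
  rw [e, e, ← Complex.exp_nat_mul]
  congr 1
  push_cast
  ring

theorem e_sub_intCast (t : ℝ) (k : ℤ) : e (t - k) = e t := by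
  rw [e, e, show (2 * Real.pi * Complex.I * ((t - k : ℝ) : ℂ) : ℂ) =
    2 * Real.pi * Complex.I * t - k * (2 * Real.pi * Complex.I) by push_cast; ring,
    Complex.exp_sub, Complex.exp_int_mul_two_pi_mul_I, div_one]

theorem exists_e_eq {z : ℂ} (hz : ‖z‖ = 1) : ∃ t : ℝ, e t = z := by
  refine ⟨z.arg / (2 * Real.pi), ?_⟩
  rw [e_eq_exp_mul_I, mul_div_cancel₀ _ Real.two_pi_pos.ne']
  have := Complex.norm_mul_exp_arg_mul_I z
  rwa [hz, Complex.ofReal_one, one_mul] at this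

theorem norm_e_sub_one_ge (t : ℝ) : 4 * |t - round t| ≤ ‖e t - 1‖ := by
  rw [← e_sub_intCast t (round t), e_eq_exp_mul_I, mul_comm _ Complex.I, Complex.norm_exp_I_mul_ofReal_sub_one,
    norm_mul, Real.norm_two, Real.norm_eq_abs,
    show 2 * Real.pi * (t - round t) / 2 = Real.pi * (t - round t) by ring,
    Real.abs_sin_eq_sin_abs_of_abs_le_pi, abs_mul, abs_of_pos Real.pi_pos]
  · have h1 := Real.mul_le_sin (x := Real.pi * |t - round t|) (by positivity) (by
      have := abs_sub_round t
      nlinarith [Real.pi_pos])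
    have h2 : 2 / Real.pi * (Real.pi * |t - round t|) = 2 * |t - round t| := by
      have := Real.pi_pos.ne'
      field_simp
    linarith
  · rw [abs_mul, abs_of_pos Real.pi_pos]
    have := abs_sub_round t
    nlinarith [Real.pi_pos]

theorem SmallDivisors.conj {C : ℝ} {κ : ℕ} {v : ℂ} (h : SmallDivisors C κ v) :
    SmallDivisors C κ (conj v) := by
  intro m hm
  have h1 : (starRingEnd ℂ) v ^ m - 1 = (starRingEnd ℂ) (v ^ m - 1) := by simp
  refine ⟨fun h2 => (h m hm).1 (sub_eq_zero.1 ?_), ?_⟩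
  · rw [h2, sub_self, eq_comm] at h1
    exact (map_eq_zero (starRingEnd ℂ)).1 h1
  · rw [h1, RCLike.norm_conj]
    exact (h m hm).2

theorem exists_smallDivisors {τ ω : ℝ}
    (hdio : ∃ c > 0, ∀ q : ℤ, 1 ≤ q →
      c ≤ (q : ℝ) ^ τ * |(q : ℝ) * ω - round ((q : ℝ) * ω)|) :
    ∃ (C : ℝ) (κ : ℕ), 0 ≤ C ∧ SmallDivisors C κ (e (2 * ω)) := by
  obtain ⟨c, hc, h⟩ := hdio
  set T := ⌈τ⌉₊
  refine ⟨6 + 3 * (2 ^ T / (2 * c)), T + 1, by positivity, fun m hm => ?_⟩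
  have hm1 : (1 : ℝ) ≤ m := by exact_mod_cast hm
  have h1 := h (2 * m) (by omega)
  push_cast at h1
  have h2 : ((2 : ℝ) * m) ^ τ ≤ (2 * m) ^ T := by
    rw [← Real.rpow_natCast]
    exact Real.rpow_le_rpow_of_exponent_le (by linarith) (Nat.le_ceil τ)
  have h3 := norm_e_sub_one_ge (2 * m * ω)
  rw [show 2 * (m : ℝ) * ω = m * (2 * ω) by ring, e_nat_mul] at h3
  rw [show 2 * (m : ℝ) * ω = m * (2 * ω) by ring] at h1
  set D := ‖e (2 * ω) ^ m - 1‖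
  have h4 : 4 * c ≤ (2 * m) ^ T * D := by
    have h5 := mul_le_mul_of_nonneg_right h2 (abs_nonneg (m * (2 * ω) - round (m * (2 * ω))))
    have h6 := mul_le_mul_of_nonneg_left h3 (by positivity : (0 : ℝ) ≤ (2 * m) ^ T)
    linarith
  have hD : 0 < D := by
    by_contra! hD
    have := mul_nonpos_of_nonneg_of_nonpos (by positivity : (0 : ℝ) ≤ (2 * m) ^ T) hD
    linarith
  refine ⟨sub_ne_zero.1 (norm_pos_iff.1 hD), ?_⟩
  have h7 : 2 / D ≤ (2 ^ T / (2 * c)) * m ^ T := by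
    rw [div_le_iff₀ hD, div_mul_eq_mul_div, div_mul_eq_mul_div, le_div_iff₀ (by positivity),
      ← mul_pow]
    linarith
  have h8 : (1 : ℝ) ≤ m ^ T := one_le_pow₀ hm1
  have h9 : (m : ℝ) ≤ m ^ (T + 1) := by rw [pow_succ]; nlinarith
  have h10 : (2 * (m : ℝ) + 1) * (2 / D) ≤ 3 * m * ((2 ^ T / (2 * c)) * m ^ T) := by
    refine mul_le_mul (by linarith) h7 (by positivity) (by positivity)
  rw [add_mul, pow_succ] at *
  linarith

theorem exists_inverse_roots_szego {a : ℕ → ℂ} {u v : ℂ} {C : ℝ} {κ : ℕ} (ha1 : ∀ k, ‖a k‖ < 1)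
    (hu : ‖u‖ = 1) (hv : ‖v‖ = 1) (ha : ∀ k, a (k + 1) = u * v ^ k * a k)
    (hC : SmallDivisors C κ v) (k : ℕ) :
    ∃ (d : ℕ) (w : Fin d → ℂ), d ≤ k ∧ PowerSumsLE C κ w ∧
      ∀ z, (szego a k).2.eval z = ∏ i, (1 - z * w i) := by
  obtain ⟨d, w, hd, hw0, hw⟩ := exists_inverse_roots _ (szego_coeff_zero a k)
  refine ⟨d, w, hd ▸ (szego_natDegree_le a k).2, ⟨?_, fun m hm => ?_⟩, fun z => ?_⟩
  · exact norm_inverse_root_le hw0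
      (hw ▸ fun z hz => norm_pos_iff.1 (norm_eval_szego_of_norm_lt_one ha1 hz k).1)
  · have h1 := norm_powerSum_szego_le_div ha1 hu hv ha hm (hC m hm).1 k
    rw [hw, coeff_powerSumSeries_coe_prod w hm] at h1
    have h2 := (hC m hm).2
    have : (0 : ℝ) ≤ m := m.cast_nonneg
    linarith
  · rw [← eval_prod_inverse_roots, ← hw]

theorem exists_zeros_szegoStep {a : ℕ → ℂ} {u v : ℂ} {C : ℝ} {κ : ℕ} (ha1 : ∀ k, ‖a k‖ < 1)
    (hu : ‖u‖ = 1) (hv : ‖v‖ = 1) (ha : ∀ k, a (k + 1) = u * v ^ k * a k)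
    (hC : SmallDivisors C κ v) (k : ℕ) {γ : ℂ} (hγ : ‖γ‖ = 1) :
    ∃ z : Fin (k + 1) → ℂ, PowerSumsLE C κ z ∧
      ∀ j, ‖z j‖ = 1 ∧ (szegoStep a k γ).eval (z j) = 0 := by
  obtain ⟨d, w, hd, hw0, hw⟩ := exists_inverse_roots _ (szegoStep_coeff_zero a k γ)
  rw [szegoStep_natDegree_eq a k (norm_ne_zero_iff.1 (by rw [hγ]; exact one_ne_zero))] at hd
  subst hd
  have h1 : ∀ i, ‖w i‖ = 1 := fun i => le_antisymm
    (norm_inverse_root_le hw0 (hw ▸ fun z hz => eval_szegoStep_ne_zero ha1 hγ.le hz k) i)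
    (norm_inverse_root_ge hw0 (hw ▸ fun z hz => eval_szegoStep_ne_zero_of_one_lt ha1 hγ hz k) i)
  refine ⟨fun j => conj (w j), ⟨fun i => by rw [RCLike.norm_conj, h1], fun m hm => ?_⟩,
    fun j => ⟨by rw [RCLike.norm_conj, h1], ?_⟩⟩
  · have h2 : ∑ i, conj (w i) ^ m = conj (∑ i, w i ^ m) := by simp
    rw [h2, RCLike.norm_conj, ← coeff_powerSumSeries_coe_prod w hm, ← hw]
    have h3 := norm_powerSum_szego_le_div ha1 hu hv ha hm (hC m hm).1 k
    have h4 := norm_powerSumIncrement_le ha1 hu hv ha hm k γ hγ.le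
    have h5 := (hC m hm).2
    rw [powerSumIncrement] at h4
    have h6 := norm_add_le
      (PowerSeries.coeff m (powerSumSeries (szegoStep a k γ : PowerSeries ℂ)) -
        PowerSeries.coeff m (powerSumSeries ((szego a k).2 : PowerSeries ℂ)))
      (PowerSeries.coeff m (powerSumSeries ((szego a k).2 : PowerSeries ℂ)))
    rw [sub_add_cancel] at h6
    linarith
  · rw [hw, eval_prod_inverse_roots]
    refine Finset.prod_eq_zero (Finset.mem_univ j) ?_
    rw [mul_comm, RCLike.mul_conj, h1]
    simp

/-- Running the Szegő recursion backwards from a zero of `szegoStep a K 1`. -/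
theorem szego_backward {a A : ℕ → ℂ} {r : ℝ} (hr : ∀ k, ‖a k‖ = r) {K : ℕ}
    (hA : ∀ l < K, A l = -conj (a (K - 1 - l))) {z : ℂ}
    (hz : z * (szego a K).1.eval z = (szego a K).2.eval z) :
    ∀ l ≤ K, z ^ l * (1 - r ^ 2 : ℂ) ^ l * (szego a (K - l)).2.eval z =
        (szego A l).1.eval z * (szego a K).2.eval z ∧
      z ^ l * (1 - r ^ 2 : ℂ) ^ l * (z * (szego a (K - l)).1.eval z) =
        (szego A l).2.eval z * (szego a K).2.eval z := by
  intro l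
  induction l with
  | zero => intro _; simp [szego, hz]
  | succ l ih =>
    intro hl
    obtain ⟨h1, h2⟩ := ih (by omega)
    obtain ⟨k, hk⟩ : ∃ k, K = k + l + 1 := ⟨K - l - 1, by omega⟩
    have e0 : K - l = k + 1 := by omega
    have e1 : K - (l + 1) = k := by omega
    have e2 : K - 1 - l = k := by omega
    have hc : a k * conj (a k) = r ^ 2 := by
      rw [RCLike.mul_conj, hr]; rfl
    have hAl := hA l (by omega)
    rw [e2] at hAl
    rw [e0] at h1 h2
    rw [e1]
    have hAc : conj (A l) = -a k := by rw [hAl]; simp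
    set Y := (szego a K).2.eval z
    simp only [szego, Polynomial.eval_sub, Polynomial.eval_mul, Polynomial.eval_C,
      Polynomial.eval_X] at h1 h2 ⊢
    rw [hAc, hAl, ← hc] at *
    constructor
    · linear_combination z * h1 + a k * h2
    · linear_combination h2 + conj (a k) * z * h1

theorem PowerSumsLE.prod_norm_ge {d κ : ℕ} {C : ℝ} {w : Fin d → ℂ} (h : PowerSumsLE C κ w)
    (hC : 0 ≤ C) {s : ℕ} (hs : 2 ≤ s) (hd : d ≤ s ^ (4 * κ + 5)) {z : ℂ} (hz : ‖z‖ ≤ 1)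
    (hzw : ∀ i, (((s ^ (4 * κ + 5) : ℕ) : ℝ) ^ 2)⁻¹ ≤ ‖1 - z * w i‖) :
    Real.exp (-(potentialConst C κ * (s : ℝ) ^ (4 * κ + 4))) ≤ ‖∏ i, (1 - z * w i)‖ := by
  have hs0 : (0 : ℝ) < s := by exact_mod_cast (by omega : 0 < s)
  have hpos : ∀ i, 0 < ‖1 - z * w i‖ := fun i => lt_of_lt_of_le (by positivity) (hzw i)
  have h1 := h.sum_log_ge hC hs hd hz fun i => by
    refine le_trans (le_of_eq ?_) (hzw i)
    push_cast
    rw [← pow_mul, mul_comm 2]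
  rw [norm_prod, ← Real.exp_log (Finset.prod_pos fun i _ => hpos i),
    Real.log_prod fun i _ => (hpos i).ne']
  exact Real.exp_le_exp.2 h1

/-- The Szegő polynomials of a rotating sequence, at some point of the unit circle, are not small
at two given places of a long interval. -/
theorem exists_szego_ge {a A : ℕ → ℂ} {u u' v : ℂ} {C r : ℝ} {κ s n K : ℕ} (hC : 0 ≤ C)
    (hr : r < 1) (har : ∀ k, ‖a k‖ = r) (hAr : ∀ k, ‖A k‖ = r) (hu : ‖u‖ = 1) (hu' : ‖u'‖ = 1)
    (hv : ‖v‖ = 1) (ha : ∀ k, a (k + 1) = u * v ^ k * a k)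
    (hA : ∀ k, A (k + 1) = u' * conj v ^ k * A k) (hd : SmallDivisors C κ v)
    (haA : ∀ l < K, A l = -conj (a (K - 1 - l))) (hs : 2 ≤ s) (hn : n = s ^ (4 * κ + 5))
    (hnC : 2 * (4 + 8 * C * κ.factorial) < n) (hK : K + 1 = 2 * n ^ (2 * κ + 2)) :
    ∃ z : ℂ, ‖z‖ = 1 ∧ z * (szego a K).1.eval z = (szego a K).2.eval z ∧
      Real.exp (-(potentialConst C κ * (s : ℝ) ^ (4 * κ + 4))) ≤ ‖(szego a n).2.eval z‖ ∧
      Real.exp (-(potentialConst C κ * (s : ℝ) ^ (4 * κ + 4))) * ‖(szego a K).2.eval z‖ ≤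
        (1 - r ^ 2) ^ n * ‖(szego a (K - n)).2.eval z‖ := by
  have hn0 : 1 ≤ n := hn ▸ Nat.one_le_pow _ _ (by omega)
  have hnK : n ≤ K := by
    have : n ≤ n ^ (2 * κ + 2) := Nat.le_self_pow (by omega) n
    omega
  have hr0 : 0 ≤ r := har 0 ▸ norm_nonneg _
  have ha1 : ∀ k, ‖a k‖ < 1 := fun k => har k ▸ hr
  have hA1 : ∀ k, ‖A k‖ < 1 := fun k => hAr k ▸ hr
  have hv' : ‖conj v‖ = 1 := by rw [RCLike.norm_conj, hv]
  obtain ⟨d, w, hdn, hw, hwe⟩ := exists_inverse_roots_szego ha1 hu hv ha hd n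
  obtain ⟨d', w', hdn', hw', hwe'⟩ := exists_inverse_roots_szego hA1 hu' hv' hA hd.conj n
  have hQ := exists_zeros_szegoStep ha1 hu hv ha hd K (γ := 1) norm_one
  rw [hK] at hQ
  obtain ⟨z, hz, hzQ⟩ := hQ
  obtain ⟨j, hj, hj'⟩ := PowerSumsLE.exists_far hw.1 hw'.1 hdn hdn' hz hC hnC
  have h0 := (hzQ j).2
  simp only [szegoStep, Polynomial.eval_sub, Polynomial.eval_mul, Polynomial.eval_C,
    Polynomial.eval_X, one_mul] at h0
  have h1 := (sub_eq_zero.1 h0).symm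
  have hz1 := (hzQ j).1
  refine ⟨z j, hz1, h1, ?_, ?_⟩
  · rw [hwe]
    exact hw.prod_norm_ge hC hs (hn ▸ hdn) hz1.le (hn ▸ hj)
  · have h2 := congrArg norm (szego_backward har haA h1 n hnK).1
    have h3 : ‖(1 - r ^ 2 : ℂ)‖ = 1 - r ^ 2 := by
      have : (1 - r ^ 2 : ℂ) = ((1 - r ^ 2 : ℝ) : ℂ) := by push_cast; rfl
      rw [this, Complex.norm_real, Real.norm_of_nonneg]
      nlinarith
    rw [norm_mul, norm_mul, norm_mul, norm_pow, norm_pow, hz1, h3, one_pow, one_mul,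
      norm_eval_szego_of_norm_eq_one A hz1, hwe'] at h2
    rw [h2]
    gcongr
    exact hw'.prod_norm_ge hC hs (hn ▸ hdn') hz1.le (hn ▸ hj')

/-- The action of `cmvL` on sequences. -/
def applyL (α f : ℤ → ℂ) (i : ℤ) : ℂ :=
  if Even i then conj (α i) * f i + rho α i * f (i + 1)
  else rho α (i - 1) * f (i - 1) - α (i - 1) * f i

/-- The action of `cmvM` on sequences. -/
def applyM (α f : ℤ → ℂ) (i : ℤ) : ℂ :=
  if Odd i then conj (α i) * f i + rho α i * f (i + 1)
  else rho α (i - 1) * f (i - 1) - α (i - 1) * f i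

theorem sum_Icc_eq_of_pair {a b i j : ℤ} (hij : i ≠ j) (g : ℤ → ℂ)
    (hg : ∀ k, k ∉ Set.Icc a b → g k = 0) (hg' : ∀ k, k ≠ i → k ≠ j → g k = 0) :
    ∑ k : Set.Icc a b, g k = g i + g j := by
  rw [← Finset.sum_pair hij, ← Finset.sum_subtype (Finset.Icc a b) (by simp) g]
  have h1 := Finset.sum_subset (Finset.subset_union_left (s₁ := Finset.Icc a b) (s₂ := {i, j}))
    (f := g) fun k _ hk => hg k (by simpa using hk)
  have h2 := Finset.sum_subset (Finset.subset_union_right (s₁ := Finset.Icc a b) (s₂ := {i, j}))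
    (f := g) fun k _ hk => hg' k (by simp at hk; tauto) (by simp at hk; tauto)
  rw [h1, h2]

theorem subL_mulVec (α : ℤ → ℂ) {a b : ℤ} {f : ℤ → ℂ} (hf : ∀ j, j ∉ Set.Icc a b → f j = 0)
    (i : Set.Icc a b) : (subL α a b *ᵥ fun j => f j) i = applyL α f i := by
  obtain ⟨i, hi⟩ := i
  have hz : ∀ k, k ∉ Set.Icc a b → cmvL α i k * f k = 0 := fun k hk => by rw [hf k hk, mul_zero]
  change ∑ k : Set.Icc a b, cmvL α i k * f k = applyL α f i
  by_cases h : Even i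
  · have h' : ¬Odd i := Int.not_odd_iff_even.2 h
    rw [sum_Icc_eq_of_pair (i := i) (j := i + 1) (by omega) (fun k => cmvL α i k * f k) hz]
    · simp [cmvL, applyL, h]
    · intro k h1 h2
      have h3 : ¬(Even k ∧ i = k + 1) := fun h3 => by
        rcases h with ⟨r, hr⟩; rcases h3.1 with ⟨t, ht⟩; omega
      simp [cmvL, h1, h2, h3]
  · have h' : Odd i := Int.not_even_iff_odd.1 h
    have h1 : Even (i - 1) := by rcases h' with ⟨r, hr⟩; exact ⟨r, by omega⟩
    rw [sum_Icc_eq_of_pair (i := i - 1) (j := i) (by omega) (fun k => cmvL α i k * f k) hz]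
    · simp [cmvL, applyL, h, h1, h', sub_eq_add_neg (_ * _)]
    · intro k h2 h3
      have h4 : i ≠ k + 1 := by omega
      simp [cmvL, h, h3, h4]

theorem subM_mulVec (α : ℤ → ℂ) {a b : ℤ} {f : ℤ → ℂ} (hf : ∀ j, j ∉ Set.Icc a b → f j = 0)
    (i : Set.Icc a b) : (subM α a b *ᵥ fun j => f j) i = applyM α f i := by
  obtain ⟨i, hi⟩ := i
  have hz : ∀ k, k ∉ Set.Icc a b → cmvM α i k * f k = 0 := fun k hk => by rw [hf k hk, mul_zero]
  change ∑ k : Set.Icc a b, cmvM α i k * f k = applyM α f i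
  by_cases h : Odd i
  · have h' : ¬Even i := Int.not_even_iff_odd.2 h
    rw [sum_Icc_eq_of_pair (i := i) (j := i + 1) (by omega) (fun k => cmvM α i k * f k) hz]
    · simp [cmvM, applyM, h]
    · intro k h1 h2
      have h3 : ¬(Odd k ∧ i = k + 1) := fun h3 => by
        rcases h with ⟨r, hr⟩; rcases h3.1 with ⟨t, ht⟩; omega
      simp [cmvM, h1, h2, h3]
  · have h' : Even i := Int.not_odd_iff_even.1 h
    have h1 : Odd (i - 1) := by rcases h' with ⟨r, hr⟩; exact ⟨r - 1, by omega⟩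
    rw [sum_Icc_eq_of_pair (i := i - 1) (j := i) (by omega) (fun k => cmvM α i k * f k) hz]
    · simp [cmvM, applyM, h, h1, h', sub_eq_add_neg (_ * _)]
    · intro k h2 h3
      have h4 : i ≠ k + 1 := by omega
      simp [cmvM, h, h3, h4]

theorem applyL_sub (α f g : ℤ → ℂ) (i : ℤ) :
    applyL α f i - applyL α g i = applyL α (fun j => f j - g j) i := by
  unfold applyL
  split_ifs <;> ring

theorem norm_rho_le (α : ℤ → ℂ) (n : ℤ) : ‖rho α n‖ ≤ 1 := by
  rw [rho, Complex.norm_real, Real.norm_of_nonneg (Real.sqrt_nonneg _)]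
  exact Real.sqrt_le_one.2 (by linarith [sq_nonneg ‖α n‖])

theorem norm_mul_add_mul_le {a b x y : ℂ} {δ : ℝ} (ha : ‖a‖ ≤ 1) (hb : ‖b‖ ≤ 1) (hx : ‖x‖ ≤ δ)
    (hy : ‖y‖ ≤ δ) : ‖a * x + b * y‖ ≤ 2 * δ ∧ ‖a * x - b * y‖ ≤ 2 * δ := by
  have h1 : ‖a * x‖ ≤ δ := by
    rw [norm_mul]; exact (mul_le_of_le_one_left (norm_nonneg _) ha).trans hx
  have h2 : ‖b * y‖ ≤ δ := by
    rw [norm_mul]; exact (mul_le_of_le_one_left (norm_nonneg _) hb).trans hy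
  exact ⟨(norm_add_le _ _).trans (by linarith), (norm_sub_le _ _).trans (by linarith)⟩

theorem norm_applyL_le {α f : ℤ → ℂ} (hα : ∀ n, ‖α n‖ ≤ 1) {δ : ℝ} (hf : ∀ n, ‖f n‖ ≤ δ) (i : ℤ) :
    ‖applyL α f i‖ ≤ 2 * δ := by
  unfold applyL
  split_ifs
  · exact (norm_mul_add_mul_le (by rw [RCLike.norm_conj]; exact hα i) (norm_rho_le α i)
      (hf _) (hf _)).1
  · exact (norm_mul_add_mul_le (norm_rho_le α _) (hα _) (hf _) (hf _)).2

/-- Place the values `p 0, …, p K` at the sites `2, …, K + 2`. -/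
def boxExt (K : ℕ) (p : ℕ → ℂ) (j : ℤ) : ℂ :=
  if 2 ≤ j ∧ j ≤ K + 2 then p (j - 2).toNat else 0

theorem boxExt_add {K k : ℕ} (hk : k ≤ K) (p : ℕ → ℂ) : boxExt K p (2 + k) = p k := by
  rw [boxExt, if_pos (by omega)]
  congr 1
  omega

theorem boxExt_of_lt (K : ℕ) (p : ℕ → ℂ) {j : ℤ} (hj : j < 2) : boxExt K p j = 0 :=
  if_neg (by omega)

theorem boxExt_of_gt {K : ℕ} (p : ℕ → ℂ) {j : ℤ} (hj : (K : ℤ) + 2 < j) : boxExt K p j = 0 :=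
  if_neg (by omega)

theorem applyL_boxExt {α : ℤ → ℂ} {K : ℕ} (hK : Odd K) {p q : ℕ → ℂ} {z : ℂ}
    (h1 : ∀ k < K, Even k → conj (α (2 + k)) * q k + rho α (2 + k) * q (k + 1) = z * p k)
    (h2 : ∀ k < K, Even k → rho α (2 + k) * q k - α (2 + k) * q (k + 1) = z * p (k + 1)) (i : ℤ) :
    applyL α (boxExt K q) i = z * boxExt K p i := by
  rcases lt_or_ge i 2 with hi | hi
  · rw [boxExt_of_lt K p hi, applyL, boxExt_of_lt K q hi]
    split_ifs with he
    · rw [boxExt_of_lt K q (by rcases he with ⟨r, hr⟩; omega)]; simp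
    · rw [boxExt_of_lt K q (by omega)]; simp
  rcases lt_or_ge ((K : ℤ) + 2) i with hi' | hi'
  · rw [boxExt_of_gt p hi', applyL, boxExt_of_gt q hi']
    split_ifs with he
    · rw [boxExt_of_gt q (by omega)]; simp
    · rw [boxExt_of_gt q (by
        rcases hK with ⟨r, hr⟩; rcases Int.not_even_iff_odd.1 he with ⟨t, ht⟩; omega)]; simp
  obtain ⟨k, rfl⟩ : ∃ k : ℕ, i = 2 + k := ⟨(i - 2).toNat, by omega⟩
  have hk : k ≤ K := by omega
  rw [applyL]
  split_ifs with he
  · have hke : Even k := by rcases he with ⟨r, hr⟩; exact ⟨(r - 1).toNat, by omega⟩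
    have hkK : k < K := by rcases hK with ⟨r, hr⟩; rcases hke with ⟨t, ht⟩; omega
    rw [boxExt_add hk, boxExt_add hk, ← h1 k hkK hke,
      show (2 + (k : ℤ) + 1) = 2 + ((k + 1 : ℕ) : ℤ) by push_cast; ring, boxExt_add hkK]
  · obtain ⟨k, rfl⟩ : ∃ m, k = m + 1 := by
      refine ⟨k - 1, ?_⟩
      rcases Int.not_even_iff_odd.1 he with ⟨t, ht⟩; omega
    have hke : Even k := by
      rcases Int.not_even_iff_odd.1 he with ⟨t, ht⟩; exact ⟨(t - 1).toNat, by push_cast at ht; omega⟩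
    rw [boxExt_add hk, boxExt_add hk, ← h2 k hk hke,
      show (2 + ((k + 1 : ℕ) : ℤ) - 1) = 2 + (k : ℤ) by push_cast; ring,
      boxExt_add (Nat.le_of_succ_le hk)]

theorem norm_applyM_boxExt_sub_le {α : ℤ → ℂ} (hα : ∀ n, ‖α n‖ ≤ 1) {K : ℕ} (hK : Odd K)
    {p q : ℕ → ℂ} {δ : ℝ}
    (h1 : ∀ k < K, Odd k → conj (α (2 + k)) * p k + rho α (2 + k) * p (k + 1) = q k)
    (h2 : ∀ k < K, Odd k → rho α (2 + k) * p k - α (2 + k) * p (k + 1) = q (k + 1))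
    (hp0 : ‖p 0‖ ≤ δ) (hq0 : ‖q 0‖ ≤ δ) (hpK : ‖p K‖ ≤ δ) (hqK : ‖q K‖ ≤ δ) (i : ℤ) :
    ‖applyM α (boxExt K p) i - boxExt K q i‖ ≤ 2 * δ := by
  have hδ : 0 ≤ δ := (norm_nonneg _).trans hp0
  have hα' : ∀ n, ‖conj (α n)‖ ≤ 1 := fun n => by rw [RCLike.norm_conj]; exact hα n
  have hz : ‖(0 : ℂ)‖ ≤ δ := by simpa using hδ
  have key : ∀ {a x y : ℂ}, ‖a‖ ≤ 1 → ‖x‖ ≤ δ → ‖y‖ ≤ δ → ‖a * x - y‖ ≤ 2 * δ := by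
    intro a x y ha hx hy
    simpa using (norm_mul_add_mul_le (b := 1) ha (by simp) hx hy).2
  rcases lt_or_ge i 1 with hi | hi
  · rw [boxExt_of_lt K q (by omega), applyM, boxExt_of_lt K p (by omega),
      boxExt_of_lt K p (by omega), boxExt_of_lt K p (by omega)]
    simpa using hδ
  rcases lt_or_ge ((K : ℤ) + 3) i with hi' | hi'
  · rw [boxExt_of_gt q (by omega), applyM, boxExt_of_gt p (by omega),
      boxExt_of_gt p (by omega), boxExt_of_gt p (by omega)]
    simpa using hδ
  have hKo : Odd (K : ℤ) := by exact_mod_cast hK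
  rcases eq_or_ne i 1 with rfl | hi1
  · have : boxExt K p (1 + 1) = p 0 := by simpa using boxExt_add (Nat.zero_le K) p
    rw [boxExt_of_lt K q (by omega), applyM, boxExt_of_lt K p (by omega), if_pos odd_one, this]
    simpa using key (norm_rho_le α 1) hp0 hz
  rcases eq_or_ne i (K + 3) with rfl | hiK
  · have : boxExt K p (K + 3 - 1) = p K := by
      rw [← boxExt_add le_rfl p]; congr 1; ring
    rw [boxExt_of_gt q (by omega), applyM, if_neg (by
      rcases hKo with ⟨t, ht⟩; rw [Int.not_odd_iff_even]; exact ⟨t + 2, by omega⟩), this,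
      boxExt_of_gt p (by omega)]
    simpa using key (norm_rho_le α _) hpK hz
  obtain ⟨k, rfl⟩ : ∃ k : ℕ, i = 2 + k := ⟨(i - 2).toNat, by omega⟩
  have hk : k ≤ K := by omega
  rw [applyM, boxExt_add hk, boxExt_add hk]
  split_ifs with ho
  · have hko : Odd k := by rcases ho with ⟨t, ht⟩; exact ⟨(t - 1).toNat, by omega⟩
    rcases hk.eq_or_lt with rfl | hkK
    · rw [boxExt_of_gt p (by omega)]
      simpa using key (hα' _) hpK hqK
    · rw [← h1 k hkK hko, show (2 + (k : ℤ) + 1) = 2 + ((k + 1 : ℕ) : ℤ) by push_cast; ring,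
        boxExt_add hkK, sub_self]
      simpa using hδ
  · rcases k with _ | k
    · rw [boxExt_of_lt K p (by simp)]
      simpa using key (a := -α (2 + 0 - 1)) (by rw [norm_neg]; exact hα _) hp0 hq0
    · have hko : Odd k := by
        rcases Int.not_odd_iff_even.1 ho with ⟨t, ht⟩
        exact ⟨(t - 2).toNat, by push_cast at ht; omega⟩
      rw [← h2 k hk hko, show (2 + ((k + 1 : ℕ) : ℤ) - 1) = 2 + (k : ℤ) by push_cast; ring,
        boxExt_add (Nat.le_of_succ_le hk), sub_self]
      simpa using hδ

theorem norm_cmvE_sub_mulVec_boxExt_le {α : ℤ → ℂ} (hα : ∀ n, ‖α n‖ ≤ 1) {K : ℕ} (hK : Odd K)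
    {t : ℤ} (ht : K + 3 ≤ t) {p q : ℕ → ℂ} {z : ℂ} {δ : ℝ}
    (hL1 : ∀ k < K, Even k → conj (α (2 + k)) * q k + rho α (2 + k) * q (k + 1) = z * p k)
    (hL2 : ∀ k < K, Even k → rho α (2 + k) * q k - α (2 + k) * q (k + 1) = z * p (k + 1))
    (hM1 : ∀ k < K, Odd k → conj (α (2 + k)) * p k + rho α (2 + k) * p (k + 1) = q k)
    (hM2 : ∀ k < K, Odd k → rho α (2 + k) * p k - α (2 + k) * p (k + 1) = q (k + 1))
    (hp0 : ‖p 0‖ ≤ δ) (hq0 : ‖q 0‖ ≤ δ) (hpK : ‖p K‖ ≤ δ) (hqK : ‖q K‖ ≤ δ) (i : Set.Icc 0 t) :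
    ‖((cmvE α 0 t - z • 1) *ᵥ fun j : Set.Icc 0 t => boxExt K p j) i‖ ≤ 4 * δ := by
  have hf : ∀ j, j ∉ Set.Icc 0 t → boxExt K p j = 0 := fun j hj => by
    rw [Set.mem_Icc] at hj
    exact if_neg (by omega)
  have hM : (subM α 0 t *ᵥ fun j : Set.Icc 0 t => boxExt K p j) = fun j : Set.Icc 0 t => applyM α (boxExt K p) j :=
    funext fun j => subM_mulVec α hf j
  have hg : ∀ j, j ∉ Set.Icc 0 t → applyM α (boxExt K p) j = 0 := fun j hj => by
    have hj' : j < 0 ∨ t < j := by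
      rw [Set.mem_Icc] at hj; omega
    rw [applyM]
    rcases hj' with hj' | hj'
    · rw [boxExt_of_lt K p (by omega), boxExt_of_lt K p (by omega), boxExt_of_lt K p (by omega)]
      simp
    · rw [boxExt_of_gt p (by omega), boxExt_of_gt p (by omega), boxExt_of_gt p (by omega)]
      simp
  have h : ((cmvE α 0 t - z • 1) *ᵥ fun j : Set.Icc 0 t => boxExt K p j) i =
      applyL α (fun j => applyM α (boxExt K p) j - boxExt K q j) i := by
    rw [← applyL_sub, applyL_boxExt hK hL1 hL2, Matrix.sub_mulVec, Pi.sub_apply, cmvE,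
      ← Matrix.mulVec_mulVec, hM, subL_mulVec α hg, Matrix.smul_mulVec, Matrix.one_mulVec]
    rfl
  rw [h]
  refine (norm_applyL_le hα (norm_applyM_boxExt_sub_le hα hK hM1 hM2 hp0 hq0 hpK hqK) i).trans ?_
  linarith

/-- The solution of the CMV transfer relations built from the Szegő recursion. -/
def cmvSol (a : ℕ → ℂ) (ρ : ℝ) (z : ℂ) (k : ℕ) : ℂ :=
  z⁻¹ ^ ((k + 1) / 2) * (if Even k then (szego a k).1.eval z else (szego a k).2.eval z) /
    (ρ : ℂ) ^ k

/-- The companion of `cmvSol`, its image under the second factor of the CMV matrix. -/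
def cmvSolDual (a : ℕ → ℂ) (ρ : ℝ) (z : ℂ) (k : ℕ) : ℂ :=
  z⁻¹ ^ (k / 2) * (if Even k then (szego a k).2.eval z else (szego a k).1.eval z) / (ρ : ℂ) ^ k

theorem norm_cmvSol (a : ℕ → ℂ) {ρ : ℝ} (hρ : 0 < ρ) {z : ℂ} (hz : ‖z‖ = 1) (k : ℕ) :
    ‖cmvSol a ρ z k‖ = ‖(szego a k).2.eval z‖ / ρ ^ k ∧
      ‖cmvSolDual a ρ z k‖ = ‖(szego a k).2.eval z‖ / ρ ^ k := by
  have h := norm_eval_szego_of_norm_eq_one a hz k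
  constructor <;>
  · simp only [cmvSol, cmvSolDual, norm_mul, norm_div, norm_pow, norm_inv, hz, inv_one, one_pow,
      one_mul, Complex.norm_real, Real.norm_of_nonneg hρ.le]
    split_ifs <;> simp [h]

theorem cmvSol_even {a : ℕ → ℂ} {ρ : ℝ} (hρ : 0 < ρ) {z : ℂ} (hz : z ≠ 0) {k : ℕ}
    (hak : (ρ : ℂ) ^ 2 = 1 - a k * conj (a k)) (hk : Even k) :
    conj (a k) * cmvSolDual a ρ z k + ρ * cmvSolDual a ρ z (k + 1) = z * cmvSol a ρ z k ∧
      ρ * cmvSolDual a ρ z k - a k * cmvSolDual a ρ z (k + 1) = z * cmvSol a ρ z (k + 1) := by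
  have hρ' : (ρ : ℂ) ≠ 0 := by exact_mod_cast hρ.ne'
  obtain ⟨h, rfl⟩ := even_iff_exists_two_mul.1 hk
  have hk' : ¬Even (2 * h + 1) := by simp
  have d1 : 2 * h / 2 = h := by omega
  have d2 : (2 * h + 1) / 2 = h := by omega
  have d3 : (2 * h + 1 + 1) / 2 = h + 1 := by omega
  simp only [cmvSol, cmvSolDual, if_pos hk, if_neg hk', d1, d2, d3, szego, Polynomial.eval_sub,
    Polynomial.eval_mul, Polynomial.eval_C, Polynomial.eval_X]
  generalize (szego a (2 * h)).1.eval z = X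
  generalize (szego a (2 * h)).2.eval z = Y
  generalize a (2 * h) = c at *
  rw [inv_pow, inv_pow, pow_succ, pow_succ]
  constructor
  · field_simp
    ring
  · field_simp
    rw [hak]
    ring

theorem cmvSol_odd {a : ℕ → ℂ} {ρ : ℝ} (hρ : 0 < ρ) {z : ℂ} (hz : z ≠ 0) {k : ℕ}
    (hak : (ρ : ℂ) ^ 2 = 1 - a k * conj (a k)) (hk : Odd k) :
    conj (a k) * cmvSol a ρ z k + ρ * cmvSol a ρ z (k + 1) = cmvSolDual a ρ z k ∧
      ρ * cmvSol a ρ z k - a k * cmvSol a ρ z (k + 1) = cmvSolDual a ρ z (k + 1) := by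
  have hρ' : (ρ : ℂ) ≠ 0 := by exact_mod_cast hρ.ne'
  have hk0 : ¬Even k := Nat.not_even_iff_odd.2 hk
  have hk' : Even (k + 1) := hk.add_one
  obtain ⟨h, rfl⟩ := hk
  have d1 : (2 * h + 1) / 2 = h := by omega
  have d2 : (2 * h + 1 + 1) / 2 = h + 1 := by omega
  have d3 : (2 * h + 1 + 1 + 1) / 2 = h + 1 := by omega
  simp only [cmvSol, cmvSolDual, if_pos hk', if_neg hk0, d1, d2, d3]
  rw [szego]
  simp only [Polynomial.eval_sub, Polynomial.eval_mul, Polynomial.eval_C, Polynomial.eval_X]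
  generalize (szego a (2 * h + 1)).1.eval z = X
  generalize (szego a (2 * h + 1)).2.eval z = Y
  generalize a (2 * h + 1) = c at *
  rw [inv_pow, inv_pow, pow_succ z, pow_succ _ (2 * h + 1)]
  constructor
  · field_simp
    ring
  · field_simp
    rw [hak]
    ring

theorem exists_quasimode {α : ℤ → ℂ} (hα : ∀ n, ‖α n‖ ≤ 1) {a : ℕ → ℂ} {r E δ : ℝ} (hr : r < 1)
    (har : ∀ k, ‖a k‖ = r) {K k₀ : ℕ} (hαa : ∀ k : ℕ, k < K → α (2 + k) = a k) (hK : Odd K)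
    {t : ℤ} (ht : K + 3 ≤ t) {z : ℂ} (hz : ‖z‖ = 1) (hE : 0 < E) (hδ : 1 ≤ δ)
    (hδK : ‖(szego a K).2.eval z‖ / √(1 - r ^ 2) ^ K ≤ δ) (hk₀ : k₀ ≤ K)
    (hE₀ : E * δ ≤ ‖(szego a k₀).2.eval z‖ / √(1 - r ^ 2) ^ k₀) :
    ∃ ψ : EuclideanSpace ℂ (Set.Icc (0 : ℤ) t), ‖ψ‖ = 1 ∧
      (∀ i : Set.Icc (0 : ℤ) t, (i : ℤ) < 2 ∨ (K : ℤ) + 2 < i → ψ i = 0) ∧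
      ‖(WithLp.equiv 2 (Set.Icc (0 : ℤ) t → ℂ)).symm ((cmvE α 0 t - z • 1).mulVec ψ)‖ ≤
        (t + 1) * 4 / E := by
  have hr0 : 0 ≤ r := har 0 ▸ norm_nonneg _
  have hρ : 0 < √(1 - r ^ 2) := Real.sqrt_pos.2 (by nlinarith)
  have hρ2 : √(1 - r ^ 2) ^ 2 = 1 - r ^ 2 := Real.sq_sqrt (by nlinarith)
  have hrho : ∀ k : ℕ, k < K → rho α (2 + k) = (√(1 - r ^ 2) : ℝ) := fun k hk => by
    rw [rho, hαa k hk, har]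
  set ρ := √(1 - r ^ 2)
  have hz0 : z ≠ 0 := norm_ne_zero_iff.1 (by rw [hz]; exact one_ne_zero)
  have hak : ∀ k, (ρ : ℂ) ^ 2 = 1 - a k * conj (a k) := fun k => by
    rw [RCLike.mul_conj, har, ← Complex.ofReal_pow, hρ2]
    push_cast
    rfl
  have h0 : ‖(szego a 0).2.eval z‖ / ρ ^ 0 ≤ δ := by simpa [szego] using hδ
  have hpt := norm_cmvE_sub_mulVec_boxExt_le hα hK ht (p := cmvSol a ρ z) (q := cmvSolDual a ρ z)
    (z := z) (δ := δ)
    (fun k hk he => by rw [hrho k hk, hαa k hk]; exact (cmvSol_even hρ hz0 (hak k) he).1)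
    (fun k hk he => by rw [hrho k hk, hαa k hk]; exact (cmvSol_even hρ hz0 (hak k) he).2)
    (fun k hk ho => by rw [hrho k hk, hαa k hk]; exact (cmvSol_odd hρ hz0 (hak k) ho).1)
    (fun k hk ho => by rw [hrho k hk, hαa k hk]; exact (cmvSol_odd hρ hz0 (hak k) ho).2)
    ((norm_cmvSol a hρ hz 0).1.trans_le h0) ((norm_cmvSol a hρ hz 0).2.trans_le h0)
    ((norm_cmvSol a hρ hz K).1.trans_le hδK) ((norm_cmvSol a hρ hz K).2.trans_le hδK)
  set φ : EuclideanSpace ℂ (Set.Icc (0 : ℤ) t) :=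
    WithLp.toLp 2 fun j : Set.Icc (0 : ℤ) t => boxExt K (cmvSol a ρ z) j with hφ
  have hφE : E * δ ≤ ‖φ‖ := by
    have h1 := PiLp.norm_apply_le φ ⟨2 + k₀, by constructor <;> omega⟩
    have h2 : φ ⟨2 + k₀, by constructor <;> omega⟩ = cmvSol a ρ z k₀ := boxExt_add hk₀ _
    rw [h2, (norm_cmvSol a hρ hz k₀).1] at h1
    exact hE₀.trans h1
  have hEδ : 0 < E * δ := by positivity
  have hφ0 : 0 < ‖φ‖ := hEδ.trans_le hφE
  refine ⟨((‖φ‖⁻¹ : ℝ) : ℂ) • φ, ?_, fun i hi => ?_, ?_⟩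
  · rw [norm_smul, Complex.norm_real, norm_inv, norm_norm, inv_mul_cancel₀ hφ0.ne']
  · have : φ i = 0 := if_neg (by omega)
    rw [PiLp.smul_apply, this, smul_zero]
  · have hsmul : (WithLp.equiv 2 (Set.Icc (0 : ℤ) t → ℂ)).symm
        ((cmvE α 0 t - z • 1).mulVec (((‖φ‖⁻¹ : ℝ) : ℂ) • φ).ofLp) =
        ((‖φ‖⁻¹ : ℝ) : ℂ) • WithLp.toLp 2 ((cmvE α 0 t - z • 1).mulVec φ) := by
      rw [WithLp.ofLp_smul, Matrix.mulVec_smul]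
      rfl
    have hN : ‖WithLp.toLp 2 ((cmvE α 0 t - z • 1).mulVec φ)‖ ≤ (t + 1) * (4 * δ) := by
      have ht0 : (0 : ℝ) ≤ t := by exact_mod_cast (by omega : (0 : ℤ) ≤ t)
      rw [EuclideanSpace.norm_eq]
      refine Real.sqrt_le_iff.2 ⟨by positivity, ?_⟩
      refine (Finset.sum_le_card_nsmul _ _ ((4 * δ) ^ 2) fun i _ => ?_).trans ?_
      · exact pow_le_pow_left₀ (norm_nonneg _) (hpt i) 2
      · have hcard : ((Fintype.card (Set.Icc (0 : ℤ) t) : ℕ) : ℝ) = t + 1 := by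
          have := Int.card_fintype_Icc_of_le (a := 0) (b := t) (by omega)
          rw [sub_zero] at this
          exact_mod_cast this
        rw [Finset.card_univ, nsmul_eq_mul, hcard, mul_pow]
        nlinarith [mul_nonneg (mul_nonneg ht0 (by positivity : 0 ≤ t + (1 : ℝ))) (sq_nonneg (4 * δ))]
    rw [hsmul, norm_smul, Complex.norm_real, norm_inv, norm_norm]
    calc ‖φ‖⁻¹ * ‖WithLp.toLp 2 ((cmvE α 0 t - z • 1).mulVec φ)‖
        ≤ (E * δ)⁻¹ * ((t + 1) * (4 * δ)) := by gcongr
      _ = (t + 1) * 4 / E := by field_simp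

theorem eventually_scale_bounds (B P η : ℝ) (D : ℕ) {L : ℝ} (hL : 0 < L) :
    ∀ᶠ s : ℕ in Filter.atTop, 2 ≤ s ∧ B < s ∧ P + η + 3 ≤ L * s ∧
      2 * (s : ℝ) ^ D + 6 ≤ Real.exp (((s : ℝ) - 1) / 2) := by
  have hcast := tendsto_natCast_atTop_atTop (R := ℝ)
  have h1 : ∀ᶠ s : ℝ in Filter.atTop, s ^ D ≤ Real.exp (-(1 / 2)) / 4 * Real.exp (1 / 2 * s) := by
    have h := (isLittleO_pow_exp_pos_mul_atTop D (by norm_num : (0 : ℝ) < 1 / 2)).bound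
      (by positivity : (0 : ℝ) < Real.exp (-(1 / 2)) / 4)
    filter_upwards [h] with s hs
    rw [Real.norm_of_nonneg (Real.exp_pos _).le] at hs
    exact (le_abs_self _).trans hs
  have h2 : ∀ᶠ s : ℝ in Filter.atTop, 12 ≤ Real.exp (-(1 / 2)) * Real.exp (1 / 2 * s) :=
    ((Real.tendsto_exp_atTop.comp (Filter.tendsto_id.const_mul_atTop
      (by norm_num : (0 : ℝ) < 1 / 2))).const_mul_atTop (Real.exp_pos _)).eventually_ge_atTop 12
  filter_upwards [Filter.eventually_ge_atTop 2, hcast.eventually_gt_atTop B,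
    (hcast.const_mul_atTop hL).eventually_ge_atTop (P + η + 3), hcast.eventually h1,
    hcast.eventually h2] with s hs2 hsB hsL hs4 hs5
  refine ⟨hs2, hsB, hsL, ?_⟩
  have : Real.exp (((s : ℝ) - 1) / 2) = Real.exp (-(1 / 2)) * Real.exp (1 / 2 * s) := by
    rw [← Real.exp_add]
    congr 1
    ring
  linarith

theorem exists_large_window {a A : ℕ → ℂ} {u u' v : ℂ} {C r : ℝ} {κ s n K : ℕ} (hC : 0 ≤ C)
    (hr : r < 1) (har : ∀ k, ‖a k‖ = r) (hAr : ∀ k, ‖A k‖ = r) (hu : ‖u‖ = 1) (hu' : ‖u'‖ = 1)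
    (hv : ‖v‖ = 1) (ha : ∀ k, a (k + 1) = u * v ^ k * a k)
    (hA : ∀ k, A (k + 1) = u' * conj v ^ k * A k) (hd : SmallDivisors C κ v)
    (haA : ∀ l < K, A l = -conj (a (K - 1 - l))) (hs : 2 ≤ s) (hn : n = s ^ (4 * κ + 5))
    (hnC : 2 * (4 + 8 * C * κ.factorial) < n) (hK : K + 1 = 2 * n ^ (2 * κ + 2)) :
    ∃ (z : ℂ) (δ : ℝ) (k₀ : ℕ), ‖z‖ = 1 ∧ 1 ≤ δ ∧ k₀ ≤ K ∧
      ‖(szego a K).2.eval z‖ / √(1 - r ^ 2) ^ K ≤ δ ∧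
      Real.exp (-(potentialConst C κ * (s : ℝ) ^ (4 * κ + 4))) / √(1 - r ^ 2) ^ n * δ ≤
        ‖(szego a k₀).2.eval z‖ / √(1 - r ^ 2) ^ k₀ := by
  obtain ⟨z, hz, -, h1, h2⟩ :=
    exists_szego_ge hC hr har hAr hu hu' hv ha hA hd haA hs hn hnC hK
  have hr0 : 0 ≤ r := har 0 ▸ norm_nonneg _
  have hρ : 0 < √(1 - r ^ 2) := Real.sqrt_pos.2 (by nlinarith)
  rw [← Real.sq_sqrt (by nlinarith : 0 ≤ 1 - r ^ 2)] at h2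
  set ρ := √(1 - r ^ 2)
  have hnK : n ≤ K := by
    have : n ≤ n ^ (2 * κ + 2) := Nat.le_self_pow (by omega) n
    have : 1 ≤ n := hn ▸ Nat.one_le_pow _ _ (by omega)
    omega
  rcases le_total (‖(szego a K).2.eval z‖ / ρ ^ K) 1 with h | h
  · refine ⟨z, 1, n, hz, le_rfl, hnK, h, ?_⟩
    rw [mul_one]
    gcongr
  · refine ⟨z, _, K - n, hz, h, Nat.sub_le K n, le_rfl, ?_⟩
    obtain ⟨m, rfl⟩ := Nat.exists_eq_add_of_le hnK
    rw [Nat.add_sub_cancel_left] at *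
    rw [div_mul_div_comm, div_le_div_iff₀ (by positivity) (by positivity)]
    calc _ ≤ (ρ ^ 2) ^ n * ‖(szego a m).2.eval z‖ * ρ ^ m := by gcongr
      _ = _ := by ring

theorem mul_div_le_rpow_neg {N η E : ℝ} (hN : 2 ≤ N) (hE : N ^ (η + 3) ≤ E) :
    N * 4 / E ≤ N ^ (-η) := by
  have hN0 : 0 < N := by linarith
  rw [div_le_iff₀ ((Real.rpow_pos_of_pos hN0 _).trans_le hE)]
  calc N * 4 ≤ N ^ 3 := by nlinarith [mul_nonneg hN0.le (by nlinarith : 0 ≤ N ^ 2 - 4)]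
    _ = N ^ (-η) * N ^ (η + 3) := by
      rw [← Real.rpow_add hN0, neg_add_cancel_left]
      norm_cast
    _ ≤ N ^ (-η) * E := by gcongr

theorem rpow_le_exp_div_pow {N P L ρ η : ℝ} {κ s : ℕ} (hN : 0 < N) (hη : 1 ≤ η)
    (hρ : ρ = Real.exp (-L)) (hs : 1 ≤ s) (hNs : Real.log N ≤ s) (hPL : P + η + 3 ≤ L * s) :
    N ^ (η + 3) ≤ Real.exp (-(P * (s : ℝ) ^ (4 * κ + 4))) / ρ ^ (s ^ (4 * κ + 5)) := by
  have hs1 : (1 : ℝ) ≤ s := by exact_mod_cast hs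
  rw [hρ, ← Real.exp_nat_mul, ← Real.exp_sub, Real.rpow_def_of_pos hN, Real.exp_le_exp]
  push_cast
  have h1 : (s : ℝ) ≤ (s : ℝ) ^ (4 * κ + 4) := le_self_pow₀ hs1 (by omega)
  have h2 : Real.log N * (η + 3) ≤ (s : ℝ) ^ (4 * κ + 4) * (L * s - P) :=
    mul_le_mul (hNs.trans h1) (by linarith) (by linarith) (by positivity)
  have h3 : (s : ℝ) ^ (4 * κ + 5) = (s : ℝ) ^ (4 * κ + 4) * s := pow_succ _ _
  rw [h3]
  linarith

/-- For Diophantine `ω` there is `σ ∈ (0,1)` such that for every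
`η ≥ 1` and all large `N`, all boundary values `β, γ ∈ ∂𝔻` and all phases `x, y`,
there is a unit vector `ψ ∈ ℂ^N` vanishing at `0`, `1` and at all coordinates
`≥ N^σ`, and a `ϑ ∈ ℝ`, with `‖(ℰ^{[0,N−1]}_{β,γ} − e(ϑ))ψ‖ ≤ N^{−η}`. -/
theorem stmt14 (τ : ℝ) (hτ : 1 < τ) (ω : ℝ)
    (hdio : ∃ c > 0, ∀ q : ℤ, 1 ≤ q →
      c ≤ (q : ℝ) ^ τ * |(q : ℝ) * ω - round ((q : ℝ) * ω)|)
    (lam : ℂ) (hlam0 : lam ≠ 0) (hlam1 : ‖lam‖ < 1) :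
    ∃ σ : ℝ, 0 < σ ∧ σ < 1 ∧
      ∀ η : ℝ, 1 ≤ η → ∃ N₀ : ℕ, ∀ N : ℕ, N₀ ≤ N →
        ∀ β γ : ℂ, ‖β‖ = 1 → ‖γ‖ = 1 → ∀ x y : ℝ, ∀ α : ℤ → ℂ,
          (∀ n : ℤ, α n = lam * e (y + (n : ℝ) * x + (n : ℝ) * ((n : ℝ) - 1) * ω)) →
          ∃ ψ : EuclideanSpace ℂ (Set.Icc (0 : ℤ) ((N : ℤ) - 1)), ‖ψ‖ = 1 ∧
            (∀ i : Set.Icc (0 : ℤ) ((N : ℤ) - 1),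
              ((i : ℤ) = 0 ∨ (i : ℤ) = 1 ∨ (N : ℝ) ^ σ ≤ ((i : ℤ) : ℝ)) → ψ i = 0) ∧
            ∃ ϑ : ℝ,
              ‖(WithLp.equiv 2 (Set.Icc (0 : ℤ) ((N : ℤ) - 1) → ℂ)).symm
                  ((cmvE (modA α 0 ((N : ℤ) - 1) β γ) 0 ((N : ℤ) - 1)
                    - e ϑ • 1).mulVec ψ)‖
                ≤ (N : ℝ) ^ (-η) := by
  obtain ⟨C, κ, hC, hd⟩ := exists_smallDivisors hdio
  refine ⟨1 / 2, by norm_num, by norm_num, fun η hη => ?_⟩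
  have hr0 : 0 < ‖lam‖ := norm_pos_iff.2 hlam0
  set ρ := √(1 - ‖lam‖ ^ 2) with hρd
  have hρ : 0 < ρ := Real.sqrt_pos.2 (by nlinarith)
  have hρ1 : ρ < 1 := by
    rw [hρd, Real.sqrt_lt' one_pos]
    nlinarith
  set L := -Real.log ρ with hLd
  have hL : 0 < L := neg_pos.2 (Real.log_neg hρ hρ1)
  have hρL : ρ = Real.exp (-L) := by rw [hLd, neg_neg, Real.exp_log hρ]
  have hev := ((tendsto_nat_ceil_atTop.comp Real.tendsto_log_atTop).comp
    (tendsto_natCast_atTop_atTop (R := ℝ))).eventually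
    (eventually_scale_bounds (2 * (4 + 8 * C * κ.factorial)) (potentialConst C κ) η
      ((4 * κ + 5) * (2 * κ + 2)) hL)
  obtain ⟨N₀, hN₀⟩ := Filter.eventually_atTop.1 (hev.and (Filter.eventually_ge_atTop 2))
  refine ⟨N₀, fun N hN β γ hβ hγ x y α hα => ?_⟩
  obtain ⟨⟨hs2, hsB, hsL, hsN⟩, hN2⟩ := hN₀ N hN
  simp only [Function.comp_apply] at hs2 hsB hsL hsN
  have hsle := Nat.le_ceil (Real.log N)
  have hslt := Nat.ceil_lt_add_one (Real.log_nonneg (x := (N : ℝ))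
    (by exact_mod_cast (by omega : 1 ≤ N)))
  set s := ⌈Real.log N⌉₊
  have hN2' : (2 : ℝ) ≤ N := by exact_mod_cast hN2
  have hN0 : (0 : ℝ) < N := by linarith
  set n := s ^ (4 * κ + 5) with hn
  obtain ⟨K, hK⟩ : ∃ K, K + 1 = 2 * n ^ (2 * κ + 2) := by
    have : 0 < n ^ (2 * κ + 2) := pow_pos (pow_pos (by omega) _) _
    exact ⟨2 * n ^ (2 * κ + 2) - 1, by omega⟩
  have hKodd : Odd K := ⟨n ^ (2 * κ + 2) - 1, by omega⟩
  have hKN : (K : ℝ) + 7 ≤ (N : ℝ) ^ (1 / 2 : ℝ) := by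
    have h1 : (K : ℝ) + 1 = 2 * (s : ℝ) ^ ((4 * κ + 5) * (2 * κ + 2)) := by
      rw [pow_mul]
      exact_mod_cast hK
    have h2 : Real.exp (((s : ℝ) - 1) / 2) ≤ (N : ℝ) ^ (1 / 2 : ℝ) := by
      rw [Real.rpow_def_of_pos hN0, Real.exp_le_exp]
      linarith
    linarith
  have hKt : (K : ℤ) + 3 ≤ (N : ℤ) - 1 := by
    have h1 : (N : ℝ) ^ (1 / 2 : ℝ) ≤ N :=
      Real.rpow_le_self_of_one_le (by linarith) (by norm_num)
    have h2 : K + 7 ≤ N := by exact_mod_cast hKN.trans h1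
    omega
  have hαn : ∀ k, ‖α k‖ = ‖lam‖ := fun k => by rw [hα, norm_mul, norm_e, mul_one]
  have haA : ∀ l : ℕ, l < K → -conj (α (K + 1 - l)) = -conj (α (2 + (K - 1 - l : ℕ))) := by
    intro l hl
    rw [show ((K : ℤ) + 1 - l) = 2 + (K - 1 - l : ℕ) by omega]
  obtain ⟨z, δ, k₀, hz, hδ, hk₀, hδK, hE₀⟩ :=
    exists_large_window (a := fun k : ℕ => α (2 + k)) (A := fun l : ℕ => -conj (α (K + 1 - l)))
      (u := e (x + 4 * ω)) (u' := e (x + 2 * K * ω)) (v := e (2 * ω)) hC hlam1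
      (fun k => hαn _) (fun k => by rw [norm_neg, RCLike.norm_conj, hαn]) (norm_e _) (norm_e _)
      (norm_e _)
      (fun k => by
        rw [hα, hα, ← e_nat_mul, mul_left_comm, ← e_add, ← e_add]
        congr 2
        push_cast
        ring)
      (fun l => by
        rw [hα, hα, ← e_neg, ← e_nat_mul, map_mul, map_mul, ← e_neg, ← e_neg, mul_neg,
          mul_left_comm, ← e_add, ← e_add]
        congr 3
        push_cast
        ring)
      hd haA hs2 hn
      (hsB.trans_le (by exact_mod_cast Nat.le_self_pow (by omega) s)) hK
  have hE := rpow_le_exp_div_pow (κ := κ) hN0 hη hρL (by omega) hsle hsL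
  obtain ⟨ψ, hψ1, hψ0, hψ⟩ := exists_quasimode (α := modA α 0 ((N : ℤ) - 1) β γ)
    (fun k => by
      unfold modA
      split_ifs
      exacts [hβ.le, hγ.le, (hαn k).le.trans hlam1.le])
    hlam1 (fun k => hαn _) (a := fun k : ℕ => α (2 + k))
    (fun k hk => by rw [modA, if_neg (by omega), if_neg (by omega)])
    hKodd hKt hz ((Real.rpow_pos_of_pos hN0 _).trans_le hE) hδ hδK hk₀ hE₀
  obtain ⟨ϑ, rfl⟩ := exists_e_eq hz
  refine ⟨ψ, hψ1, fun i hi => hψ0 i ?_, ϑ, hψ.trans ?_⟩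
  · rcases hi with hi | hi | hi
    · left; omega
    · left; omega
    · right
      have : (K : ℝ) + 7 ≤ (i : ℤ) := hKN.trans hi
      have : (K : ℤ) + 7 ≤ i := by exact_mod_cast this
      omega
  · have : (((N : ℤ) - 1 : ℤ) : ℝ) + 1 = N := by push_cast; ring
    rw [this]
    exact mul_div_le_rpow_neg hN2' hE
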